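/- Let q ≥ 3 be a prime power, r a prime dividing q−1, and let P = {p_1,...,p_L} be a set of L distinct monic irreducible polynomials of degree exactly 2 in F_q[x]. If L < (q(r−1)−1)/(2r√q), then the (r,P)-shadow code C(χ_r,P) has F_r-dimension exactly L. -/

import Mathlib

/-- The shadow-code evaluation map. -/
noncomputable def shadowEv {F : Type} [Field F] [Fintype F] {r L : ℕ}
    (χ : Fˣ →* (rootsOfUnity r ℂ)) (φ : (rootsOfUnity r ℂ) → ZMod r)
    (p : Fin L → Polynomial F) (hnz : ∀ i (x : F), (p i).eval x ≠ 0) :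
    (Fin L → ZMod r) → (F → ZMod r) :=
  fun v x => φ (χ (∏ i, (Units.mk0 ((p i).eval x) (hnz i x)) ^ (v i).val))

open Polynomial


theorem sc_hasse_dvd {R : Type*} [CommRing R] (f : R[X]) (t : ℕ) :
    ∀ (m : ℕ) (a : R[X]), f ^ (t - m) ∣ hasseDeriv m (a * f ^ t) := by
  induction t with
  | zero => intro m a; simp
  | succ t ih =>
    intro m a
    have h : a * f ^ (t + 1) = f * (a * f ^ t) := by ring
    rw [h, hasseDeriv_mul]
    refine Finset.dvd_sum ?_
    rintro ⟨i, j⟩ hij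
    rw [Finset.HasAntidiagonal.mem_antidiagonal] at hij
    simp only at hij ⊢
    rcases Nat.eq_zero_or_pos i with rfl | hi
    · have : j = m := by omega
      subst this
      rw [hasseDeriv_zero']
      refine (pow_dvd_pow f (show t + 1 - j ≤ (t - j) + 1 by omega)).trans ?_
      rw [pow_succ']
      exact mul_dvd_mul_left _ (ih _ _)
    · refine Dvd.dvd.mul_left ((pow_dvd_pow f (show t + 1 - m ≤ t - j by omega)).trans (ih _ _)) _

theorem sc_hasse_quot {R : Type*} [Field R] (f a : R[X]) (hf : f.Monic) (t m : ℕ) :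
    ∃ N : R[X], f ^ m * hasseDeriv m (a * f ^ t) = N * f ^ t ∧
      N.natDegree ≤ m * f.natDegree + a.natDegree := by
  have h1 : f ^ t ∣ f ^ m * hasseDeriv m (a * f ^ t) := by
    refine (pow_dvd_pow f (show t ≤ m + (t - m) by omega)).trans ?_
    rw [pow_add]
    exact mul_dvd_mul_left _ (sc_hasse_dvd f t m a)
  obtain ⟨N, hN⟩ := h1
  refine ⟨N, by rw [hN, mul_comm], ?_⟩
  have h2 : (f ^ t * N).natDegree ≤ m * f.natDegree + (a.natDegree + t * f.natDegree) := by
    rw [← hN]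
    refine natDegree_mul_le.trans ?_
    rw [hf.natDegree_pow]
    gcongr
    refine (natDegree_hasseDeriv_le _ _).trans ?_
    refine (Nat.sub_le _ _).trans (natDegree_mul_le.trans ?_)
    rw [hf.natDegree_pow]
  rcases eq_or_ne N 0 with rfl | hN0
  · simp
  rw [(hf.pow t).natDegree_mul' hN0, hf.natDegree_pow] at h2
  omega

/-- distinct vanishing orders imply independence -/
theorem sc_indep {R ι : Type*} [Field R] [Fintype ι] (α : R) (n : ι → ℕ) (hn : Function.Injective n)
    (u : ι → R[X]) (hu : ∀ i, (u i).eval α ≠ 0) (c : ι → R)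
    (h : ∑ i, C (c i) * ((X - C α) ^ n i * u i) = 0) : c = 0 := by
  classical
  by_contra hc
  have hne : (Finset.univ.filter fun i => c i ≠ 0).Nonempty := by
    obtain ⟨i, hi⟩ := Function.ne_iff.mp hc
    exact ⟨i, by simpa using hi⟩
  obtain ⟨i, hi, hmin⟩ := Finset.exists_min_image _ n hne
  simp only [Finset.mem_filter, Finset.mem_univ, true_and] at hi hmin
  rw [← Finset.add_sum_erase _ _ (Finset.mem_univ i)] at h
  have hd : (X - C α) ^ (n i + 1) ∣ ∑ x ∈ Finset.univ.erase i, C (c x) * ((X - C α) ^ n x * u x) := by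
    refine Finset.dvd_sum fun j hj => ?_
    rcases eq_or_ne (c j) 0 with h0 | h0
    · simp [h0]
    · have h1 := hmin j h0
      have h2 : n i ≠ n j := fun h => (Finset.ne_of_mem_erase hj) (hn h).symm
      exact Dvd.dvd.mul_left (Dvd.dvd.mul_right (pow_dvd_pow _ (by omega)) _) _
  have hd2 : (X - C α) ^ (n i + 1) ∣ C (c i) * ((X - C α) ^ n i * u i) := by
    rw [eq_neg_of_add_eq_zero_left h]
    exact (dvd_neg).mpr hd
  rw [show C (c i) * ((X - C α) ^ n i * u i) = (X - C α) ^ n i * (C (c i) * u i) by ring, pow_succ] at hd2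
  have h3 := (mul_dvd_mul_iff_left (pow_ne_zero _ (X_sub_C_ne_zero α))).mp hd2
  rw [dvd_iff_isRoot] at h3
  simp [IsRoot, hi, hu] at h3

theorem sc_inj_aux {r s v A K : ℕ} (hr : r.Prime) (hv : ¬ r ∣ v) (hA : A + v ≤ s) :
    Function.Injective (fun i : Fin r × Fin K × Fin A =>
      (i.2.2 : ℕ) + (r * s + 1) * (i.2.1 : ℕ) + v * (i.1 * s)) := by
  have key : ∀ (j j' : Fin r) (k k' : Fin K) (l l' : Fin A),
      (l : ℕ) + (r * s + 1) * (k : ℕ) + v * (j * s) = (l' : ℕ) + (r * s + 1) * (k' : ℕ) + v * (j' * s) →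
      j = j' := by
    intro j j' k k' l l' h
    by_contra hne
    have hj := j.2
    have hj' := j'.2
    have hne' : (j : ℤ) - j' ≠ 0 := by
      intro h0; apply hne; ext; omega
    have hnd : ¬ (r : ℤ) ∣ ((j : ℤ) - j') * v := by
      intro hd
      rcases (Nat.prime_iff_prime_int.mp hr).dvd_or_dvd hd with h1 | h1
      · have := Int.eq_zero_of_abs_lt_dvd h1 (by rw [abs_lt]; omega)
        exact hne' this
      · exact hv (by exact_mod_cast h1)
    zify at h
    set J : ℤ := (j : ℤ) - j' with hJ
    have e1 : ((r : ℤ) * s + 1) * ((r : ℤ) * ((k : ℤ) - k') + J * v) = J * v - r * ((l : ℤ) - l') := by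
      rw [hJ]; linear_combination (r : ℤ) * h
    have hne2 : (r : ℤ) * ((k : ℤ) - k') + J * v ≠ 0 := by
      intro h0
      apply hnd
      exact ⟨-((k : ℤ) - k'), by linear_combination h0⟩
    have habs : |J * v - r * ((l : ℤ) - l')| ≤ (r : ℤ) * v + r * (A - 1) := by
      have hJ1 : |J| ≤ r := by rw [abs_le]; omega
      have hl1 : |(l : ℤ) - l'| ≤ A - 1 := by
        have := l.2; have := l'.2
        rw [abs_le]; omega
      calc |J * v - r * ((l : ℤ) - l')| ≤ |J * v| + |r * ((l : ℤ) - l')| := abs_sub _ _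
        _ = |J| * v + r * |(l : ℤ) - l'| := by rw [abs_mul, abs_mul]; simp
        _ ≤ _ := by gcongr
    rw [← e1, abs_mul] at habs
    have h5 : (1 : ℤ) ≤ |(r : ℤ) * ((k : ℤ) - k') + J * v| := Int.one_le_abs hne2
    have h6 : |(r : ℤ) * s + 1| = (r : ℤ) * s + 1 := abs_of_nonneg (by positivity)
    rw [h6] at habs
    have h7 : ((r : ℤ) * s + 1) * 1 ≤ ((r : ℤ) * s + 1) * |(r : ℤ) * ((k : ℤ) - k') + J * v| := by gcongr
    have h8 : (r : ℤ) * (A + v) ≤ r * s := by gcongr; exact_mod_cast hA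
    have : 0 < (r : ℤ) := by exact_mod_cast hr.pos
    nlinarith
  rintro ⟨j, k, l⟩ ⟨j', k', l'⟩ h
  simp only at h
  have hj := key j j' k k' l l' h
  subst hj
  have h' : (l : ℕ) + (r * s + 1) * (k : ℕ) = (l' : ℕ) + (r * s + 1) * (k' : ℕ) := by omega
  have hs : s ≤ r * s := Nat.le_mul_of_pos_left _ hr.pos
  have hl := l.2
  have hl' := l'.2
  have h1 := congrArg (· % (r * s + 1)) h'
  simp only [Nat.add_mul_mod_self_left] at h1
  rw [Nat.mod_eq_of_lt (by omega), Nat.mod_eq_of_lt (by omega)] at h1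
  have h2 : (k : ℕ) = k' := by
    rw [h1] at h'
    exact Nat.eq_of_mul_eq_mul_left (Nat.succ_pos (r * s)) (Nat.add_left_cancel h')
  have h1' := Fin.ext h1
  have h2' := Fin.ext h2
  subst h1' h2'
  rfl

theorem sc_dvd_of_hasse {R : Type*} [Field R] (g : R[X]) (x : R) (M : ℕ)
    (h : ∀ m < M, (hasseDeriv m g).eval x = 0) : (X - C x) ^ M ∣ g := by
  have h1 : X ^ M ∣ taylor x g := by
    rw [X_pow_dvd_iff]
    intro d hd
    rw [taylor_coeff]; exact h d hd
  obtain ⟨w, hw⟩ := h1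
  refine ⟨taylor (-x) w, ?_⟩
  have := congrArg (taylor (-x)) hw
  rw [taylor_taylor, taylor_mul] at this
  simp only [neg_add_cancel, taylor_zero, taylor_X_pow] at this
  rw [this]; simp [sub_eq_add_neg]

theorem sc_stepanov {Om : Type*} [Field Om] (p k₀ : ℕ) [Fact p.Prime] [CharP Om p]
    {r s v A K M : ℕ} (hQ : p ^ k₀ = r * s + 1)
    (hr : r.Prime) (hv : ¬ r ∣ v) (hA : A + v ≤ s) (hMQ : M ≤ r * s + 1)
    (f f0 : Om[X]) (α : Om) (hf : f.Monic) (hf0 : f = (X - C α) ^ v * f0) (hα : f0.eval α ≠ 0)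
    (hcount : M * (M * f.natDegree + A + K) < r * K * A)
    (b : Om) (Z : Finset Om) (hZ : ∀ x ∈ Z, x ^ (r * s + 1) = x ∧ f.eval x ≠ 0 ∧ f.eval x ^ s = b) :
    Z.card * M ≤ (r * s + 1) * (K + f.natDegree) := by
  classical
  set Q := r * s + 1 with hQdef
  set e := f.natDegree with he
  choose N hN hNdeg using fun (j m l : ℕ) => sc_hasse_quot f ((X - C α) ^ l) hf (j * s) m
  let ι := Fin r × Fin K × Fin A
  let κ := Fin M × Fin (M * e + A + K)
  let B : ℕ → ι → Om[X] := fun m i => C (b ^ (i.1 : ℕ)) * (N i.1 m i.2.2 * (X - C (α ^ Q)) ^ (i.2.1 : ℕ))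
  let Mat : Matrix κ ι Om := fun a i => (B a.1 i).coeff a.2
  have hker : LinearMap.ker Mat.mulVecLin ≠ ⊥ := by
    apply LinearMap.ker_ne_bot_of_finrank_lt
    simp only [ι, κ, Module.finrank_fintype_fun_eq_card, Fintype.card_prod, Fintype.card_fin]
    rw [← mul_assoc]; exact hcount
  obtain ⟨c, hc, hc0⟩ := Submodule.exists_mem_ne_zero_of_ne_bot hker
  rw [LinearMap.mem_ker, Matrix.mulVecLin_apply] at hc
  have hBdeg : ∀ m < M, ∀ i, (B m i).natDegree < M * e + A + K := by
    intro m hm i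
    have h1 : (B m i).natDegree ≤ 0 + ((m * e + i.2.2) + i.2.1) := by
      refine natDegree_mul_le.trans (add_le_add (natDegree_C _).le (natDegree_mul_le.trans (add_le_add ?_ ?_)))
      · refine (hNdeg _ _ _).trans ?_
        simp [he]
      · rw [natDegree_pow, natDegree_X_sub_C, mul_one]
    have := i.2.2.2
    have := i.2.1.2
    have : m * e ≤ M * e := Nat.mul_le_mul_right _ hm.le
    omega
  have hW : ∀ m < M, ∑ i, C (c i) * B m i = 0 := by
    intro m hm
    ext n
    simp only [finsetSum_coeff, coeff_C_mul, coeff_zero]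
    by_cases hn : n < M * e + A + K
    · have := congrFun hc (⟨m, hm⟩, ⟨n, hn⟩)
      simp only [Matrix.mulVec, dotProduct, Mat, Pi.zero_apply] at this
      rw [← this]
      exact Finset.sum_congr rfl fun i _ => mul_comm _ _
    · refine Finset.sum_eq_zero fun i _ => ?_
      rw [coeff_eq_zero_of_natDegree_lt ((hBdeg m hm i).trans_le (not_lt.mp hn)), mul_zero]
  set Φ : Om[X] := ∑ i : ι, C (c i) * ((X - C α) ^ ((i.2.2 : ℕ) + Q * i.2.1) * f ^ ((i.1 : ℕ) * s)) with hΦ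
  have hΦ0 : Φ ≠ 0 := by
    intro h0
    apply hc0
    refine sc_indep α _ (sc_inj_aux (K := K) hr hv hA) (fun i => f0 ^ ((i.1 : ℕ) * s)) ?_ c ?_
    · intro i; simp [hα]
    · rw [← h0, hΦ]
      refine Finset.sum_congr rfl fun i _ => ?_
      rw [hf0]; ring
  have hchar : ∀ g h : Om[X], (g - h) ^ Q = g ^ Q - h ^ Q := by
    intro g h
    rw [← hQ]
    have : ExpChar Om[X] p := ExpChar.prime Fact.out
    exact sub_pow_expChar_pow g h _
  have hdvd : ∀ x ∈ Z, (X - C x) ^ M ∣ Φ := by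
    intro x hx
    obtain ⟨hxQ, hfx, hfb⟩ := hZ x hx
    set Ψ : Om[X] := ∑ i : ι, C (c i * (x - α ^ Q) ^ (i.2.1 : ℕ)) * ((X - C α) ^ (i.2.2 : ℕ) * f ^ ((i.1 : ℕ) * s)) with hΨ
    have h1 : (X - C x) ^ Q ∣ Φ - Ψ := by
      rw [hΦ, hΨ, ← Finset.sum_sub_distrib]
      refine Finset.dvd_sum fun i _ => ?_
      have h2 : (X - C x) ^ Q ∣ ((X - C α) ^ Q) ^ (i.2.1 : ℕ) - (C (x - α ^ Q)) ^ (i.2.1 : ℕ) := by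
        refine dvd_trans ?_ (sub_dvd_pow_sub_pow _ _ _)
        have h8 : (C x : Om[X]) ^ Q = C x := by rw [← C_pow, hxQ]
        rw [hchar, hchar, C_sub, C_pow, h8]
        apply dvd_of_eq; ring
      have h3 : C (c i) * ((X - C α) ^ ((i.2.2 : ℕ) + Q * i.2.1) * f ^ ((i.1 : ℕ) * s)) -
          C (c i * (x - α ^ Q) ^ (i.2.1 : ℕ)) * ((X - C α) ^ (i.2.2 : ℕ) * f ^ ((i.1 : ℕ) * s)) =
          (((X - C α) ^ Q) ^ (i.2.1 : ℕ) - (C (x - α ^ Q)) ^ (i.2.1 : ℕ)) *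
            (C (c i) * (X - C α) ^ (i.2.2 : ℕ) * f ^ ((i.1 : ℕ) * s)) := by
        rw [C_mul, C_pow, pow_add, pow_mul]; ring
      rw [h3]
      exact Dvd.dvd.mul_right h2 _
    have h4 : (X - C x) ^ M ∣ Ψ := by
      apply sc_dvd_of_hasse
      intro m hm
      have h5 : f.eval x ^ m * (hasseDeriv m Ψ).eval x = (∑ i, C (c i) * B m i).eval x := by
        rw [hΨ, map_sum, eval_finsetSum, eval_finsetSum, Finset.mul_sum]
        refine Finset.sum_congr rfl fun i _ => ?_
        have h6 := congrArg (eval x) (hN i.1 m i.2.2)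
        simp only [eval_mul, eval_pow] at h6
        rw [← smul_eq_C_mul, map_smul, eval_smul, smul_eq_mul]
        simp only [B, eval_mul, eval_pow, eval_C, eval_sub, eval_X]
        have h9 : f.eval x ^ ((i.1 : ℕ) * s) = b ^ (i.1 : ℕ) := by
          rw [mul_comm (i.1 : ℕ) s, pow_mul, hfb]
        rw [h9] at h6
        linear_combination (c i * (x - α ^ Q) ^ (i.2.1 : ℕ)) * h6
      rw [hW m hm, eval_zero] at h5
      exact (mul_eq_zero.mp h5).resolve_left (pow_ne_zero _ hfx)
    have h7 := dvd_add ((pow_dvd_pow (X - C x) hMQ).trans h1) h4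
    rwa [sub_add_cancel] at h7
  have hprod : (∏ x ∈ Z, (X - C x) ^ M) ∣ Φ := by
    refine Finset.prod_dvd_of_coprime ?_ hdvd
    intro x _ y _ hxy
    exact (isCoprime_X_sub_C_of_isUnit_sub (sub_ne_zero.mpr hxy).isUnit).pow
  have hdeg := natDegree_le_of_dvd hprod hΦ0
  rw [natDegree_prod_of_monic _ _ (fun x _ => (monic_X_sub_C x).pow M)] at hdeg
  simp only [natDegree_pow, natDegree_X_sub_C, mul_one, Finset.sum_const, smul_eq_mul] at hdeg
  refine hdeg.trans ?_
  apply natDegree_sum_le_of_forall_le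
  intro i _
  refine (natDegree_C_mul_le _ _).trans (natDegree_mul_le.trans ?_)
  rw [natDegree_pow, natDegree_X_sub_C, hf.natDegree_pow, mul_one]
  have a1 := i.2.2.2
  have a2 := i.2.1.2
  have a3 := i.1.2
  have hsQ : s ≤ Q := by
    have : s ≤ r * s := Nat.le_mul_of_pos_left _ hr.pos
    omega
  have b1 : Q * (i.2.1 : ℕ) + Q ≤ Q * K := by
    rw [← Nat.mul_succ]; exact Nat.mul_le_mul_left _ a2
  have b2 : (i.1 : ℕ) * s * f.natDegree ≤ Q * f.natDegree := by
    apply Nat.mul_le_mul_right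
    have : (i.1 : ℕ) * s ≤ r * s := Nat.mul_le_mul_right _ a3.le
    omega
  rw [mul_add, he]
  omega

set_option maxHeartbeats 1000000 in
theorem sc_stepanov_bound {Om : Type*} [Field Om] (p : ℕ) [Fact p.Prime] [CharP Om p]
    {r v : ℕ} (hr : r.Prime) (hv : ¬ r ∣ v)
    (f f0 : Om[X]) (α : Om) (hf : f.Monic) (hf0 : f = (X - C α) ^ v * f0) (hα : f0.eval α ≠ 0) :
    ∃ D : ℝ, 0 ≤ D ∧ ∀ (k₀ s : ℕ), p ^ k₀ = r * s + 1 → 1 ≤ s → ∀ (b : Om) (Z : Finset Om),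
      (∀ x ∈ Z, x ^ (r * s + 1) = x ∧ f.eval x ≠ 0 ∧ f.eval x ^ s = b) →
      (r : ℝ) * Z.card ≤ (r * s + 1 : ℕ) + D * √((r * s + 1 : ℕ) : ℝ) := by
  set e := f.natDegree with he
  set c := 4 * r ^ 2 * (r * e + 1) + 1 with hc
  set S0 := 2 * v + 1 + c ^ 2 with hS0
  refine ⟨((2 * (c + r * e) + r * (r * S0 + 1) : ℕ) : ℝ), by positivity, ?_⟩
  intro k₀ s hQ hs b Z hZ
  have hr2 := hr.two_le
  set Q := r * s + 1 with hQd
  have hsqrt1 : (1 : ℝ) ≤ √(Q : ℝ) := by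
    rw [Real.one_le_sqrt]; exact_mod_cast (by omega : 1 ≤ Q)
  have hsq : √(Q : ℝ) * √(Q : ℝ) = Q := Real.mul_self_sqrt (by positivity)
  rcases lt_or_ge s S0 with hsmall | hbig
  · have hZQ : Z.card ≤ Q := by
      classical
      have hne : (X ^ Q - X : Om[X]) ≠ 0 := FiniteField.X_pow_card_sub_X_ne_zero Om (by nlinarith)
      have hdeg : (X ^ Q - X : Om[X]).natDegree = Q :=
        FiniteField.X_pow_card_sub_X_natDegree_eq Om (by nlinarith)
      rw [← hdeg]
      apply Polynomial.card_le_degree_of_subset_roots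
      intro x hx
      rw [mem_roots hne]
      have := (hZ x hx).1
      simp [IsRoot, this]
    have h1 : r * Z.card ≤ r * (r * S0 + 1) := by
      apply Nat.mul_le_mul_left
      refine hZQ.trans ?_
      rw [hQd]
      gcongr
    have h2 : (r : ℝ) * Z.card ≤ ((r * (r * S0 + 1) : ℕ) : ℝ) := by exact_mod_cast h1
    have h3 : ((r * (r * S0 + 1) : ℕ) : ℝ) ≤ ((2 * (c + r * e) + r * (r * S0 + 1) : ℕ) : ℝ) := by
      exact_mod_cast Nat.le_add_left _ _
    have h4 : ((2 * (c + r * e) + r * (r * S0 + 1) : ℕ) : ℝ) * 1 ≤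
        ((2 * (c + r * e) + r * (r * S0 + 1) : ℕ) : ℝ) * √(Q : ℝ) := by gcongr
    have h5 : (0 : ℝ) ≤ Q := by positivity
    linarith
  · set K := Nat.sqrt Q with hK
    have hKQ : K * K ≤ Q := Nat.sqrt_le Q
    have hsQ : s ≤ Q := by
      have : s ≤ r * s := Nat.le_mul_of_pos_left _ hr.pos
      omega
    have hKc : c ≤ K := by
      rw [hK, Nat.le_sqrt, ← pow_two]
      exact le_trans (le_trans (Nat.le_add_left _ _) hbig) hsQ
    have hrc : r ≤ c := by
      have h1 : r ≤ r ^ 2 := Nat.le_self_pow (by norm_num) r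
      have h2 : r ^ 2 * 1 ≤ r ^ 2 * (r * e + 1) := Nat.mul_le_mul_left _ (by omega)
      have h3 : 4 * r ^ 2 * (r * e + 1) = 4 * (r ^ 2 * (r * e + 1)) := by ring
      omega
    obtain ⟨A, hA⟩ : ∃ A, s = A + v := ⟨s - v, by omega⟩
    obtain ⟨M, hM⟩ : ∃ M, r * K = M + c := ⟨r * K - c, by
      have : K ≤ r * K := Nat.le_mul_of_pos_left _ hr.pos
      omega⟩
    have hMK : K ≤ M := by
      have := Nat.mul_le_mul_right K hr2
      omega
    have hsv : 2 * v + 1 ≤ s := le_trans (Nat.le_add_right _ _) hbig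
    have hA0 : 0 < A := by omega
    have hQA : Q ≤ 4 * r * A := by
      have : s ≤ 2 * A := by omega
      have h1 : r * s ≤ r * (2 * A) := Nat.mul_le_mul_left _ this
      have h2 : 1 ≤ r * A := Nat.mul_pos hr.pos hA0
      have h3 : r * (2 * A) = 2 * (r * A) := by ring
      have h4 : 4 * r * A = 4 * (r * A) := by ring
      omega
    have hMQ : M ≤ Q := by
      have : r * K ≤ K * K := Nat.mul_le_mul_right _ (hrc.trans hKc)
      omega
    have hcount : M * (M * e + A + K) < r * K * A := by
      have h1 : M * (M * e + K) ≤ (r * K) * ((r * K) * e + K) := by gcongr <;> omega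
      have h2 : (r * K) * ((r * K) * e + K) = K * K * (r * (r * e + 1)) := by ring
      have h3 : K * K * (r * (r * e + 1)) ≤ (4 * r * A) * (r * (r * e + 1)) := by
        exact Nat.mul_le_mul_right _ (hKQ.trans hQA)
      have h4 : (4 * r * A) * (r * (r * e + 1)) + A = c * A := by rw [hc]; ring
      rw [hM]
      have h5 : M * (M * e + A + K) = M * (M * e + K) + M * A := by ring
      rw [h5, add_mul]
      omega
    clear_value c S0
    have main := sc_stepanov p k₀ hQ hr hv hA.ge hMQ f f0 α hf hf0 hα hcount b Z hZ
    have main' : ((Z.card * M : ℕ) : ℝ) ≤ ((r * s + 1) * (K + f.natDegree) : ℕ) := by exact_mod_cast main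
    rw [← hQd, ← he] at main'
    have hM' : (r : ℝ) * K = M + c := by exact_mod_cast hM
    push_cast at main'
    have h6 : ((r : ℝ) * Z.card - Q) * M ≤ Q * (c + r * e) := by
      have : (r : ℝ) * (Z.card * M) ≤ r * (Q * (K + e)) := by gcongr
      have h7 : (r : ℝ) * (Q * (K + e)) = Q * (r * K + r * e) := by ring
      rw [h7, hM'] at this
      linarith
    have h8 : √(Q : ℝ) ≤ 2 * M := by
      have h9 : Q < (K + 1) * (K + 1) := Nat.lt_succ_sqrt Q
      have h10 : Q ≤ (2 * M) ^ 2 := by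
        have : K + 1 ≤ 2 * M := by omega
        have := Nat.mul_le_mul this this
        rw [pow_two]
        omega
      rw [Real.sqrt_le_left (by positivity)]
      exact_mod_cast h10
    have h11 : (r : ℝ) * Z.card - Q ≤ 2 * (c + r * e) * √(Q : ℝ) := by
      by_contra hcon
      push Not at hcon
      have hpos : (0 : ℝ) ≤ (r : ℝ) * Z.card - Q := le_trans (by positivity) hcon.le
      have h12 : ((r : ℝ) * Z.card - Q) * √(Q : ℝ) ≤ ((r : ℝ) * Z.card - Q) * (2 * M) := by gcongr
      have h13 : 2 * (c + r * e) * √(Q : ℝ) * √(Q : ℝ) < ((r : ℝ) * Z.card - Q) * √(Q : ℝ) := by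
        gcongr
      rw [mul_assoc, hsq] at h13
      linarith
    have h14 : (2 * (c + r * e) : ℝ) ≤ ((2 * (c + r * e) + r * (r * S0 + 1) : ℕ) : ℝ) := by
      push_cast
      have : (0 : ℝ) ≤ r * (r * S0 + 1) := by positivity
      linarith
    have h15 : (2 * (c + r * e) : ℝ) * √(Q : ℝ) ≤ ((2 * (c + r * e) + r * (r * S0 + 1) : ℕ) : ℝ) * √(Q : ℝ) := by
      gcongr
    linarith


theorem sc_root_bound (c S : ℕ → ℂ) (d : ℕ) (hd : ∀ n, d ≤ n → c n = 0) (hc0 : c 0 = 1)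
    (w B : ℝ) (hw : 0 < w) (hS : ∀ n, ‖S n‖ ≤ B * w ^ n)
    (hN : ∀ n : ℕ, (n : ℂ) * c n = ∑ ij ∈ Finset.HasAntidiagonal.antidiagonal n, S ij.1 * c ij.2)
    (P : ℂ[X]) (hP : ∀ n, P.coeff n = c n) (t : ℂ) (ht : P.eval t = 0) : 1 ≤ ‖t‖ * w := by
  by_contra hcon
  push Not at hcon
  have hPdeg : P.natDegree < d + 1 := by
    rw [Nat.lt_succ_iff, natDegree_le_iff_coeff_eq_zero]
    intro n hn; rw [hP, hd n hn.le]
  have hP0 : P ≠ 0 := by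
    intro h; have := hP 0; rw [h, hc0] at this; simp at this
  have ht0 : t ≠ 0 := by
    rintro rfl
    rw [← coeff_zero_eq_eval_zero, hP, hc0] at ht
    exact one_ne_zero ht
  obtain ⟨ρ, hρ1, hρ2⟩ : ∃ ρ, ‖t‖ < ρ ∧ ρ * w < 1 := by
    have : ‖t‖ < 1 / w := by rw [lt_div_iff₀ hw]; exact hcon
    obtain ⟨ρ, h1, h2⟩ := exists_between this
    exact ⟨ρ, h1, by rwa [lt_div_iff₀ hw] at h2⟩
  have hρ0 : 0 < ρ := (norm_nonneg t).trans_lt hρ1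
  have hB : 0 ≤ B := by have := hS 0; simp at this; exact (norm_nonneg _).trans this
  have hgeo : Summable fun n : ℕ => B * (ρ * w) ^ n :=
    (summable_geometric_of_lt_one (by positivity) hρ2).mul_left B
  set B' := ∑' n : ℕ, B * (ρ * w) ^ n with hB'
  have key : ∀ z : ℂ, ‖z‖ ≤ ρ → ‖z‖ * ‖P.derivative.eval z‖ ≤ B' * ‖P.eval z‖ := by
    intro z hz
    have hterm : ∀ n, ‖S n * z ^ n‖ ≤ B * (ρ * w) ^ n := by
      intro n
      rw [norm_mul, norm_pow]
      calc ‖S n‖ * ‖z‖ ^ n ≤ (B * w ^ n) * ρ ^ n := by gcongr; exact hS n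
        _ = _ := by rw [mul_pow]; ring
    have hsumS : Summable fun n => ‖S n * z ^ n‖ := Summable.of_nonneg_of_le (fun _ => norm_nonneg _) hterm hgeo
    have hsumc : Summable fun n => ‖c n * z ^ n‖ := by
      apply summable_of_ne_finset_zero (s := Finset.range (d + 1))
      intro n hn
      rw [Finset.mem_range, not_lt] at hn
      rw [hd n (by omega)]; simp
    have e1 : P.eval z = ∑' n, c n * z ^ n := by
      rw [eval_eq_sum_range' hPdeg, tsum_eq_sum (s := Finset.range (d + 1))]
      · simp [hP]
      · intro n hn
        rw [Finset.mem_range, not_lt] at hn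
        rw [hd n (by omega)]; simp
    have e2 : z * P.derivative.eval z = ∑' n : ℕ, (n : ℂ) * c n * z ^ n := by
      have : z * P.derivative.eval z = (X * P.derivative).eval z := by simp
      rw [this, eval_eq_sum_range' (n := d + 1), tsum_eq_sum (s := Finset.range (d + 1))]
      · refine Finset.sum_congr rfl fun n _ => ?_
        cases n with
        | zero => simp
        | succ n => rw [coeff_X_mul, coeff_derivative, hP]; push_cast; ring
      · intro n hn
        rw [Finset.mem_range, not_lt] at hn
        rw [hd n (by omega)]; simp
      · rw [Nat.lt_succ_iff, natDegree_le_iff_coeff_eq_zero]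
        intro n hn
        cases n with
        | zero => simp
        | succ n => rw [coeff_X_mul, coeff_derivative, hP, hd _ hn.le, zero_mul]
    have e3 : z * P.derivative.eval z = (∑' n, S n * z ^ n) * P.eval z := by
      rw [e1, tsum_mul_tsum_eq_tsum_sum_antidiagonal_of_summable_norm hsumS hsumc, e2]
      congr 1; ext n
      rw [hN n, Finset.sum_mul]
      refine Finset.sum_congr rfl fun ij hij => ?_
      rw [Finset.HasAntidiagonal.mem_antidiagonal] at hij
      rw [← hij, pow_add]; ring
    rw [← norm_mul, e3, norm_mul]
    gcongr
    calc ‖∑' n, S n * z ^ n‖ ≤ ∑' n, ‖S n * z ^ n‖ := norm_tsum_le_tsum_norm hsumS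
      _ ≤ B' := hsumS.tsum_le_tsum hterm hgeo
  obtain ⟨e, he, hne⟩ := exists_eq_pow_rootMultiplicity_mul_and_not_dvd P hP0 t
  set m := P.rootMultiplicity t with hm
  have hm1 : 1 ≤ m := (rootMultiplicity_pos hP0).mpr ht
  have het : e.eval t ≠ 0 := by rwa [dvd_iff_isRoot] at hne
  obtain ⟨k, hk⟩ : ∃ k, m = k + 1 := ⟨m - 1, by omega⟩
  rw [hk] at he
  have hder : P.derivative = (X - C t) ^ k * (C ((k + 1 : ℕ) : ℂ) * e + (X - C t) * e.derivative) := by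
    rw [he, derivative_mul, derivative_X_sub_C_pow]
    simp only [Nat.add_sub_cancel, map_natCast]
    ring
  set G : ℂ[X] := C ((k + 1 : ℕ) : ℂ) * e + (X - C t) * e.derivative with hG
  have key2 : ∀ z : ℂ, ‖z‖ ≤ ρ → z ≠ t → ‖z‖ * ‖G.eval z‖ ≤ B' * (‖z - t‖ * ‖e.eval z‖) := by
    intro z hz hzt
    have h := key z hz
    rw [hder, he] at h
    simp only [eval_mul, eval_pow, eval_sub, eval_X, eval_C, norm_mul, norm_pow, pow_succ] at h
    have hpos : 0 < ‖z - t‖ ^ k := pow_pos (norm_pos_iff.mpr (sub_ne_zero.mpr hzt)) _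
    have h' : ‖z - t‖ ^ k * (‖z‖ * ‖G.eval z‖) ≤ ‖z - t‖ ^ k * (B' * (‖z - t‖ * ‖e.eval z‖)) := by
      linarith
    exact le_of_mul_le_mul_left h' hpos
  have hcont1 : Filter.Tendsto (fun z : ℂ => ‖z‖ * ‖G.eval z‖) (nhdsWithin t {t}ᶜ) (nhds (‖t‖ * ‖G.eval t‖)) := by
    apply Filter.Tendsto.mono_left _ nhdsWithin_le_nhds
    exact (Continuous.tendsto (by fun_prop) t)
  have hcont2 : Filter.Tendsto (fun z : ℂ => B' * (‖z - t‖ * ‖e.eval z‖)) (nhdsWithin t {t}ᶜ) (nhds (B' * (‖t - t‖ * ‖e.eval t‖))) := by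
    apply Filter.Tendsto.mono_left _ nhdsWithin_le_nhds
    exact (Continuous.tendsto (f := fun z : ℂ => B' * (‖z - t‖ * ‖e.eval z‖)) (by fun_prop) t)
  have hev : ∀ᶠ z in nhdsWithin t {t}ᶜ, ‖z‖ * ‖G.eval z‖ ≤ B' * (‖z - t‖ * ‖e.eval z‖) := by
    have h1 : ∀ᶠ z in nhdsWithin t {t}ᶜ, ‖z‖ < ρ :=
      nhdsWithin_le_nhds (continuous_norm.continuousAt.eventually_lt continuousAt_const hρ1)
    filter_upwards [h1, self_mem_nhdsWithin] with z hz hzt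
    exact key2 z hz.le hzt
  have hfin := le_of_tendsto_of_tendsto hcont1 hcont2 hev
  simp only [sub_self, norm_zero, zero_mul, mul_zero] at hfin
  have hGt : G.eval t = (k + 1 : ℕ) * e.eval t := by simp [hG]
  rw [hGt] at hfin
  have : 0 < ‖t‖ * ‖((k + 1 : ℕ) : ℂ) * e.eval t‖ := by
    apply mul_pos (norm_pos_iff.mpr ht0) (norm_pos_iff.mpr (mul_ne_zero _ het))
    exact_mod_cast Nat.succ_ne_zero k
  linarith

theorem sc_analytic (c S : ℕ → ℂ) (d : ℕ) (hd : ∀ n, d + 1 ≤ n → c n = 0) (hc0 : c 0 = 1)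
    (w B : ℝ) (hw : 0 < w) (hS : ∀ n, ‖S n‖ ≤ B * w ^ n)
    (hN : ∀ n : ℕ, (n : ℂ) * c n = ∑ ij ∈ Finset.HasAntidiagonal.antidiagonal n, S ij.1 * c ij.2) :
    ‖c 1‖ ≤ d * w := by
  set P : ℂ[X] := ∑ n ∈ Finset.range (d + 1), monomial n (c n) with hPdef
  have hP : ∀ n, P.coeff n = c n := by
    intro n
    rw [hPdef, finsetSum_coeff]
    simp only [coeff_monomial, Finset.sum_ite_eq', Finset.mem_range]
    split_ifs with h
    · rfl
    · rw [hd n (by omega)]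
  have hPdeg : P.natDegree ≤ d := by
    rw [natDegree_le_iff_coeff_eq_zero]
    intro n hn; rw [hP, hd n hn]
  have hP0 : P.coeff 0 ≠ 0 := by rw [hP, hc0]; exact one_ne_zero
  have hPne : P ≠ 0 := by rintro h; rw [h] at hP0; simp at hP0
  have htr : P.natTrailingDegree = 0 := natTrailingDegree_eq_zero.mpr (Or.inr hP0)
  have hrdeg : P.reverse.natDegree = P.natDegree := by
    rw [reverse_natDegree, htr, Nat.sub_zero]
  have hmon : P.reverse.Monic := by
    rw [Monic, reverse_leadingCoeff, trailingCoeff, htr, hP, hc0]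
  rcases Nat.eq_zero_or_pos P.natDegree with h0 | hpos
  · rw [← hP 1, coeff_eq_zero_of_natDegree_lt (by omega)]
    simp; positivity
  have hb := coeff_le_of_roots_le (p := P.reverse) (f := RingHom.id ℂ) (B := w) (P.natDegree - 1) hmon
    (IsAlgClosed.splits _) (by
      intro z hz
      rw [map_id, mem_roots hmon.ne_zero] at hz
      have hz0 : z ≠ 0 := by
        rintro rfl
        rw [IsRoot, ← coeff_zero_eq_eval_zero, coeff_zero_reverse] at hz
        exact hPne (leadingCoeff_eq_zero.mp hz)
      have h1 : P.eval z⁻¹ = 0 := by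
        letI : Invertible z⁻¹ := invertibleOfNonzero (inv_ne_zero hz0)
        have := (eval₂_reverse_eq_zero_iff (RingHom.id ℂ) z⁻¹ P).mp (by
          rw [invOf_eq_inv, inv_inv]; exact hz)
        exact this
      have h2 := sc_root_bound c S (d + 1) hd hc0 w B hw hS hN P hP _ h1
      rw [norm_inv] at h2
      have hzpos : 0 < ‖z‖ := norm_pos_iff.mpr hz0
      rw [inv_mul_eq_div, le_div_iff₀ hzpos] at h2
      linarith)
  rw [map_id, hrdeg, coeff_reverse, revAt_le (by omega), show P.natDegree - (P.natDegree - 1) = 1 by omega,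
    hP, pow_one, Nat.choose_symm (by omega : 1 ≤ P.natDegree), Nat.choose_one_right] at hb
  refine hb.trans ?_
  rw [mul_comm]
  gcongr


theorem sc_mon_finite (F : Type) [Field F] [Fintype F] (n : ℕ) :
    {g : F[X] | g.Monic ∧ g.natDegree = n}.Finite := by
  have h : ((degreeLT F (n + 1) : Submodule F F[X]) : Set F[X]).Finite := by
    have : Finite (degreeLT F (n + 1)) := Finite.of_equiv _ (degreeLTEquiv F (n + 1)).symm.toEquiv
    exact Set.toFinite _
  refine h.subset ?_
  rintro g ⟨_, hg⟩
  rw [SetLike.mem_coe, mem_degreeLT]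
  exact lt_of_le_of_lt degree_le_natDegree (by rw [hg]; exact_mod_cast Nat.lt_succ_self n)

noncomputable def scMon (F : Type) [Field F] [Fintype F] (n : ℕ) : Finset F[X] :=
  (sc_mon_finite F n).toFinset

theorem mem_scMon {F : Type} [Field F] [Fintype F] {n : ℕ} {g : F[X]} :
    g ∈ scMon F n ↔ g.Monic ∧ g.natDegree = n := by simp [scMon]

open Classical in
noncomputable def scE (F : Type) [Field F] [Fintype F] (k : ℕ) : Finset (AlgebraicClosure F) :=
  (X ^ (Fintype.card F) ^ k - X : (AlgebraicClosure F)[X]).roots.toFinset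

theorem scE_zero (F : Type) [Field F] [Fintype F] : scE F 0 = ∅ := by simp [scE]

theorem mem_scE' {F : Type} [Field F] [Fintype F] {k : ℕ} (hk : 1 ≤ k) {x : AlgebraicClosure F} :
    x ∈ scE F k ↔ x ^ (Fintype.card F) ^ k = x := by
  have hne : (X ^ (Fintype.card F) ^ k - X : (AlgebraicClosure F)[X]) ≠ 0 :=
    FiniteField.X_pow_card_pow_sub_X_ne_zero _ (by omega) Fintype.one_lt_card
  simp only [scE, Multiset.mem_toFinset, mem_roots hne, IsRoot, eval_sub, eval_pow, eval_X, sub_eq_zero]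

theorem sc_int {F : Type} [Field F] [Fintype F] (x : AlgebraicClosure F) : IsIntegral F x :=
  Algebra.IsIntegral.isIntegral x

theorem mem_scE {F : Type} [Field F] [Fintype F] {k : ℕ} (hk : 1 ≤ k) {x : AlgebraicClosure F} :
    x ∈ scE F k ↔ (minpoly F x).natDegree ∣ k := by
  rw [mem_scE' hk, (minpoly.irreducible (sc_int x)).natDegree_dvd_iff_dvd_X_pow_card_pow_sub_X,
    minpoly.dvd_iff, Nat.card_eq_fintype_card]
  simp [sub_eq_zero]

theorem card_scE (F : Type) [Field F] [Fintype F] {k : ℕ} (hk : 1 ≤ k) :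
    (scE F k).card = (Fintype.card F) ^ k := by
  classical
  have hsep : (X ^ (Fintype.card F) ^ k - X : (AlgebraicClosure F)[X]).Separable := by
    obtain ⟨p, hp⟩ := CharP.exists F
    have := charP_of_injective_algebraMap (algebraMap F (AlgebraicClosure F)).injective p
    apply galois_poly_separable p
    have h1 : (p : F) = 0 := CharP.cast_eq_zero F p
    have : p ∣ Fintype.card F := (CharP.cast_eq_zero_iff F p _).mp (Nat.cast_card_eq_zero F)
    exact dvd_pow this (by omega)
  rw [scE, Multiset.toFinset_card_of_nodup (nodup_roots hsep),
    ← (IsAlgClosed.splits (X ^ (Fintype.card F) ^ k - X : (AlgebraicClosure F)[X])).natDegree_eq_card_roots]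
  exact FiniteField.X_pow_card_pow_sub_X_natDegree_eq _ (by omega) Fintype.one_lt_card

theorem sc_pow_dvd {F : Type} [Field F] [Fintype F] (x : AlgebraicClosure F) (g : F[X]) (hg : g ≠ 0) (j : ℕ) :
    (minpoly F x) ^ j ∣ g ↔ j ≤ (g.map (algebraMap F (AlgebraicClosure F))).rootMultiplicity x := by
  classical
  set π := minpoly F x with hπ
  have hirr : Irreducible π := minpoly.irreducible (sc_int x)
  have hπ0 : π ≠ 0 := hirr.ne_zero
  have hmon : π.Monic := minpoly.monic (sc_int x)
  obtain ⟨h, hh, hnd⟩ := (finiteMultiplicity_of_degree_pos_of_monic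
    (minpoly.degree_pos (sc_int x)) hmon hg).exists_eq_pow_mul_and_not_dvd
  set s := multiplicity π g
  have hh0 : h ≠ 0 := by rintro rfl; simp at hnd
  have hinj := (algebraMap F (AlgebraicClosure F)).injective
  have hmul : (g.map (algebraMap F (AlgebraicClosure F))).rootMultiplicity x = s := by
    rw [hh, Polynomial.map_mul, Polynomial.map_pow, rootMultiplicity_mul, ← count_roots (p := _ ^ s), roots_pow, Multiset.count_nsmul, count_roots]
    · have h1 : (π.map (algebraMap F (AlgebraicClosure F))).rootMultiplicity x = 1 := by
        apply le_antisymm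
        · exact rootMultiplicity_le_one_of_separable ((PerfectField.separable_of_irreducible hirr).map) x
        · rw [Nat.one_le_iff_ne_zero, Nat.ne_zero_iff_zero_lt, rootMultiplicity_pos (map_ne_zero hπ0)]
          simp [hπ, IsRoot, eval_map_algebraMap]
      have h2 : (h.map (algebraMap F (AlgebraicClosure F))).rootMultiplicity x = 0 := by
        apply rootMultiplicity_eq_zero
        rw [IsRoot, eval_map_algebraMap, ← minpoly.dvd_iff]
        exact hnd
      rw [h1, h2]; ring
    · exact mul_ne_zero (pow_ne_zero _ (map_ne_zero hπ0)) (map_ne_zero hh0)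
  rw [hmul]
  constructor
  · intro hd
    exact ((finiteMultiplicity_of_degree_pos_of_monic
      (minpoly.degree_pos (sc_int x)) hmon hg).pow_dvd_iff_le_multiplicity).mp hd
  · intro hj
    rw [hh]
    exact Dvd.dvd.mul_right (pow_dvd_pow _ hj) _

noncomputable def scD {F : Type} [Field F] [Fintype F] (k : ℕ) (x : AlgebraicClosure F) : F[X] :=
  (minpoly F x) ^ (k / (minpoly F x).natDegree)

theorem scD_mem {F : Type} [Field F] [Fintype F] {k : ℕ} {x : AlgebraicClosure F} (hx : x ∈ scE F k) :
    scD k x ∈ scMon F k := by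
  rcases Nat.eq_zero_or_pos k with rfl | hk
  · rw [scE_zero] at hx; simp at hx
  rw [mem_scE hk] at hx
  rw [mem_scMon, scD]
  refine ⟨(minpoly.monic (sc_int x)).pow _, ?_⟩
  rw [natDegree_pow, Nat.div_mul_cancel hx]

open Classical in
theorem sc_count {F : Type} [Field F] [Fintype F] {n : ℕ} {g : F[X]} (hg : g ∈ scMon F n) :
    ∑ i ∈ Finset.range (n + 1), ((scE F i).filter (fun x => scD i x ∣ g)).card = n := by
  rw [mem_scMon] at hg
  obtain ⟨hgm, hgn⟩ := hg
  have hg0 := hgm.ne_zero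
  set R := g.aroots (AlgebraicClosure F) with hR
  have h1 : ∀ i ∈ Finset.range (n + 1), ((scE F i).filter (fun x => scD i x ∣ g)).card
      = ∑ x ∈ R.toFinset, if (x ∈ scE F i ∧ scD i x ∣ g) then 1 else 0 := by
    intro i _
    rw [← Finset.card_filter]
    congr 1
    ext x
    simp only [Finset.mem_filter]
    refine ⟨fun h => ⟨?_, h⟩, fun h => h.2⟩
    rcases Nat.eq_zero_or_pos i with rfl | hi
    · rw [scE_zero] at h; simp at h
    rw [Multiset.mem_toFinset, hR, mem_aroots]
    refine ⟨hg0, ?_⟩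
    rw [← minpoly.dvd_iff]
    refine dvd_trans (dvd_pow_self _ ?_) h.2
    have h3 := (mem_scE hi).mp h.1
    have := Nat.div_pos (Nat.le_of_dvd hi h3) (minpoly.natDegree_pos (sc_int x))
    omega
  rw [Finset.sum_congr rfl h1, Finset.sum_comm]
  have h2 : ∀ x ∈ R.toFinset, (∑ i ∈ Finset.range (n + 1), if (x ∈ scE F i ∧ scD i x ∣ g) then 1 else 0)
      = R.count x := by
    intro x _
    rw [← Finset.card_filter, hR, aroots, count_roots]
    set μ := (g.map (algebraMap F (AlgebraicClosure F))).rootMultiplicity x with hμ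
    set m := (minpoly F x).natDegree with hm
    have hm0 : 0 < m := minpoly.natDegree_pos (sc_int x)
    have hle : μ * m ≤ n := by
      have := natDegree_le_of_dvd ((sc_pow_dvd x g hg0 μ).mpr le_rfl) hg0
      rwa [natDegree_pow, hgn] at this
    have : (Finset.range (n + 1)).filter (fun i => x ∈ scE F i ∧ scD i x ∣ g) =
        (Finset.Icc 1 μ).image (fun j => j * m) := by
      ext i
      simp only [Finset.mem_filter, Finset.mem_range, Finset.mem_image, Finset.mem_Icc]
      constructor
      · rintro ⟨h3, h4, h5⟩
        rcases Nat.eq_zero_or_pos i with rfl | hi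
        · rw [scE_zero] at h4; simp at h4
        rw [mem_scE hi] at h4
        rw [scD, sc_pow_dvd x g hg0] at h5
        exact ⟨i / m, ⟨Nat.div_pos (Nat.le_of_dvd hi h4) hm0, h5⟩, Nat.div_mul_cancel h4⟩
      · rintro ⟨j, ⟨hj1, hj2⟩, rfl⟩
        have h6 : j * m ≤ μ * m := Nat.mul_le_mul_right _ hj2
        refine ⟨by omega, (mem_scE (Nat.mul_pos hj1 hm0)).mpr (Dvd.intro_left _ rfl), ?_⟩
        rw [scD, sc_pow_dvd x g hg0, ← hm, Nat.mul_div_cancel _ hm0]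
        exact hj2
    rw [this, Finset.card_image_of_injective, Nat.card_Icc]
    · omega
    · intro a b hab
      exact Nat.eq_of_mul_eq_mul_right hm0 hab
  rw [Finset.sum_congr rfl h2, Multiset.toFinset_sum_count_eq, hR, aroots,
    ← (IsAlgClosed.splits _).natDegree_eq_card_roots, natDegree_map, hgn]

noncomputable def scC {F : Type} [Field F] [Fintype F] (ψ : F[X] →* ℂ) (n : ℕ) : ℂ :=
  ∑ g ∈ scMon F n, ψ g

noncomputable def scS {F : Type} [Field F] [Fintype F] (ψ : F[X] →* ℂ) (n : ℕ) : ℂ :=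
  ∑ x ∈ scE F n, ψ (scD n x)

theorem sc_newton {F : Type} [Field F] [Fintype F] (ψ : F[X] →* ℂ) (n : ℕ) :
    (n : ℂ) * scC ψ n = ∑ ij ∈ Finset.HasAntidiagonal.antidiagonal n, scS ψ ij.1 * scC ψ ij.2 := by
  classical
  have h1 : ∀ i ∈ Finset.range (n + 1), scS ψ i * scC ψ (n - i) =
      ∑ g ∈ scMon F n, ψ g * ((scE F i).filter (fun x => scD i x ∣ g)).card := by
    intro i hi
    rw [Finset.mem_range] at hi
    have h2 : ∀ x ∈ scE F i, ψ (scD i x) * scC ψ (n - i) =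
        ∑ g ∈ scMon F n, if scD i x ∣ g then ψ g else 0 := by
      intro x hx
      obtain ⟨hDm, hDd⟩ := mem_scMon.mp (scD_mem hx)
      rw [← Finset.sum_filter, scC, Finset.mul_sum]
      refine Finset.sum_bij (fun h _ => scD i x * h) ?_ ?_ ?_ ?_
      · intro h hh
        rw [mem_scMon] at hh
        rw [Finset.mem_filter, mem_scMon]
        refine ⟨⟨hDm.mul hh.1, ?_⟩, dvd_mul_right _ _⟩
        rw [hDm.natDegree_mul hh.1, hDd, hh.2]; omega
      · intro a _ b _ hab
        exact mul_left_cancel₀ hDm.ne_zero hab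
      · intro g hg
        rw [Finset.mem_filter, mem_scMon] at hg
        obtain ⟨⟨hgm, hgd⟩, h, rfl⟩ := hg
        have hhm : h.Monic := hDm.of_mul_monic_left hgm
        refine ⟨h, ?_, rfl⟩
        rw [mem_scMon]
        refine ⟨hhm, ?_⟩
        rw [hDm.natDegree_mul hhm, hDd] at hgd
        omega
      · intro h _
        rw [map_mul]
    rw [scS, Finset.sum_mul, Finset.sum_congr rfl h2, Finset.sum_comm]
    refine Finset.sum_congr rfl fun g _ => ?_
    rw [← Finset.sum_filter, Finset.sum_const, nsmul_eq_mul, mul_comm]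
  rw [Finset.Nat.sum_antidiagonal_eq_sum_range_succ (fun i j => scS ψ i * scC ψ j), Finset.sum_congr rfl h1,
    Finset.sum_comm, scC, Finset.mul_sum]
  refine Finset.sum_congr rfl fun g hg => ?_
  rw [← Finset.mul_sum, ← Nat.cast_sum, sc_count hg, mul_comm]


noncomputable def scN {F : Type} [Field F] (p : F[X]) : F[X] →* F :=
  (Algebra.norm F).comp (AdjoinRoot.mk p : F[X] →* AdjoinRoot p)

theorem scN_congr {F : Type} [Field F] (p g h : F[X]) (hd : p ∣ g - h) : scN p g = scN p h := by
  have : AdjoinRoot.mk p g = AdjoinRoot.mk p h := AdjoinRoot.mk_eq_mk.mpr hd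
  simp [scN, this]

theorem scN_roots {F : Type} [Field F] [Fintype F] (p : F[X]) (hp : Irreducible p) (g : F[X]) :
    algebraMap F (AlgebraicClosure F) (scN p g) =
      ((p.aroots (AlgebraicClosure F)).map (fun α => aeval α g)).prod := by
  classical
  have : Fact (Irreducible p) := ⟨hp⟩
  have : FiniteDimensional F (AdjoinRoot p) := (AdjoinRoot.powerBasis hp.ne_zero).finite
  have hnd : (p.aroots (AlgebraicClosure F)).Nodup :=
    nodup_roots (PerfectField.separable_of_irreducible hp).map
  have h1 := Algebra.norm_eq_prod_embeddings F (AlgebraicClosure F) (AdjoinRoot.mk p g)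
  have h2 : algebraMap F (AlgebraicClosure F) (scN p g) = ∏ σ : AdjoinRoot p →ₐ[F] AlgebraicClosure F, σ (AdjoinRoot.mk p g) := h1
  rw [h2]
  have h3 : ∀ σ : AdjoinRoot p →ₐ[F] AlgebraicClosure F, σ (AdjoinRoot.mk p g) = aeval (σ (AdjoinRoot.root p)) g := by
    intro σ
    rw [← AdjoinRoot.aeval_eq, ← Polynomial.aeval_algHom_apply]
  simp only [h3]
  have h4 : (p.aroots (AlgebraicClosure F)) = (p.aroots (AlgebraicClosure F)).toFinset.val := by
    rw [Multiset.toFinset_val, hnd.dedup]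
  rw [h4]
  change _ = ∏ α ∈ (p.aroots (AlgebraicClosure F)).toFinset, aeval α g
  refine Finset.prod_bij (fun σ _ => σ (AdjoinRoot.root p)) ?_ ?_ ?_ ?_
  · intro σ _
    rw [Multiset.mem_toFinset, mem_aroots]
    refine ⟨hp.ne_zero, ?_⟩
    rw [Polynomial.aeval_algHom_apply]
    simp
  · intro σ _ τ _ h
    exact AdjoinRoot.algHom_ext h
  · intro α hα
    rw [Multiset.mem_toFinset, mem_aroots] at hα
    exact ⟨AdjoinRoot.liftAlgHom p (Algebra.ofId F _) α (by rw [← hα.2]; rfl), Finset.mem_univ _, AdjoinRoot.liftAlgHom_root _ _ _ _⟩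
  · intro σ _; rfl

theorem scN_surj {F : Type} [Field F] [Fintype F] (p : F[X]) (hp : Irreducible p) (w : F) :
    ∃ g : F[X], scN p g = w := by
  have : Fact (Irreducible p) := ⟨hp⟩
  have : FiniteDimensional F (AdjoinRoot p) := (AdjoinRoot.powerBasis hp.ne_zero).finite
  have : Finite (AdjoinRoot p) := Module.finite_of_finite F
  obtain ⟨y, hy⟩ := FiniteField.norm_surjective F (AdjoinRoot p) w
  obtain ⟨g, rfl⟩ := AdjoinRoot.mk_surjective y
  exact ⟨g, hy⟩

theorem sc_range {F : Type} [Field F] [Fintype F] {y : AlgebraicClosure F} (hy : y ^ Fintype.card F = y) :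
    y ∈ (algebraMap F (AlgebraicClosure F)).range := by
  have h1 : y ∈ scE F 1 := by rw [mem_scE' le_rfl]; simpa using hy
  rw [mem_scE le_rfl, Nat.dvd_one] at h1
  exact minpoly.natDegree_eq_one_iff.mp h1

theorem scD_map {F : Type} [Field F] [Fintype F] {n : ℕ} {x : AlgebraicClosure F} (hx : x ∈ scE F n) :
    (scD n x).map (algebraMap F (AlgebraicClosure F)) =
      ∏ j ∈ Finset.range n, (X - C (x ^ (Fintype.card F) ^ j)) := by
  classical
  have hDm := scD_mem hx
  rcases Nat.eq_zero_or_pos n with rfl | hn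
  · rw [scE_zero] at hx; simp at hx
  have hm := (mem_scE hn).mp hx
  have hxn := (mem_scE' hn).mp hx
  set q := Fintype.card F with hq
  set G : (AlgebraicClosure F)[X] := ∏ j ∈ Finset.range n, (X - C (x ^ q ^ j)) with hG
  have hGm : G.Monic := monic_prod_of_monic _ _ (fun j _ => monic_X_sub_C _)
  have hGd : G.natDegree = n := by
    rw [hG, natDegree_prod_of_monic _ _ (fun j _ => monic_X_sub_C _)]
    simp only [natDegree_X_sub_C]; simp
  have hfix : G.map (FiniteField.frobeniusAlgHom F (AlgebraicClosure F) : AlgebraicClosure F →+* AlgebraicClosure F) = G := by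
    rw [hG, Polynomial.map_prod]
    simp only [Polynomial.map_sub, map_X, map_C]
    have e : ∀ j, (FiniteField.frobeniusAlgHom F (AlgebraicClosure F) : AlgebraicClosure F →+* AlgebraicClosure F) (x ^ q ^ j) = x ^ q ^ (j+1) := by
      intro j
      simp [FiniteField.frobeniusAlgHom_apply, ← pow_mul, pow_succ, hq]
    simp only [e]
    obtain ⟨k, rfl⟩ : ∃ k, n = k + 1 := ⟨n - 1, by omega⟩
    rw [Finset.prod_range_succ, Finset.prod_range_succ', hxn]
    simp
  have hl : G ∈ lifts (algebraMap F (AlgebraicClosure F)) := by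
    rw [lifts_iff_coeff_lifts]
    intro i
    have h1 := congrArg (fun P => P.coeff i) hfix
    simp only [coeff_map] at h1
    exact sc_range (by simpa [FiniteField.frobeniusAlgHom_apply, hq] using h1)
  obtain ⟨g, hg⟩ := (mem_lifts _).mp hl
  have hgm : g.Monic := by
    rw [← hg] at hGm
    exact monic_of_injective (algebraMap F (AlgebraicClosure F)).injective hGm
  have hgd : g.natDegree = n := by rw [← hGd, ← hg, natDegree_map]
  have hxj : ∀ j, x ^ q ^ ((minpoly F x).natDegree * j) = x := by
    intro j
    rcases Nat.eq_zero_or_pos ((minpoly F x).natDegree * j) with h | h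
    · simp [h]
    · exact (mem_scE' h).mp ((mem_scE h).mpr (dvd_mul_right _ _))
  have hmpos : 0 < (minpoly F x).natDegree := minpoly.natDegree_pos (sc_int x)
  have hdvd : scD n x ∣ g := by
    unfold scD
    rw [sc_pow_dvd x g hgm.ne_zero, hg, le_rootMultiplicity_iff hGm.ne_zero, hG]
    have h1 : (Finset.range (n / (minpoly F x).natDegree)).image (fun j => (minpoly F x).natDegree * j) ⊆ Finset.range n := by
      intro i hi
      simp only [Finset.mem_image, Finset.mem_range] at hi ⊢
      obtain ⟨j, hj, rfl⟩ := hi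
      rw [mul_comm]
      exact (Nat.lt_div_iff_mul_lt' hm j).mp hj |> fun h => by rw [mul_comm]; exact h
    refine dvd_trans ?_ (Finset.prod_dvd_prod_of_subset _ _ _ h1)
    rw [Finset.prod_image]
    · simp [hxj]
    · intro a _ b _ h
      exact Nat.eq_of_mul_eq_mul_left hmpos h
  rw [mem_scMon] at hDm
  rw [← hg]
  congr 1
  exact eq_of_monic_of_dvd_of_natDegree_le hDm.1 hgm hdvd (by rw [hgd, hDm.2]) |>.symm


theorem scN_scD {F : Type} [Field F] [Fintype F] (p : F[X]) (hp : Irreducible p) (hm : p.Monic) (hd : p.natDegree = 2)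
    {n : ℕ} {x : AlgebraicClosure F} (hx : x ∈ scE F n) :
    algebraMap F (AlgebraicClosure F) (scN p (scD n x)) =
      (aeval x p) ^ (∑ j ∈ Finset.range n, (Fintype.card F) ^ j) := by
  have hsp : p.map (algebraMap F (AlgebraicClosure F)) =
      ((p.aroots (AlgebraicClosure F)).map (fun α => X - C α)).prod :=
    (IsAlgClosed.splits _).eq_prod_roots_of_monic (hm.map _)
  have hcard : (p.aroots (AlgebraicClosure F)).card = 2 := by
    rw [← hd, ← natDegree_map (algebraMap F (AlgebraicClosure F))]
    exact ((IsAlgClosed.splits _).natDegree_eq_card_roots).symm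
  rw [scN_roots p hp]
  obtain ⟨a, b, hab⟩ := Multiset.card_eq_two.mp hcard
  rw [hab] at hsp ⊢
  have he : ∀ y : AlgebraicClosure F, aeval y p = (y - a) * (y - b) := by
    intro y
    rw [aeval_def, ← eval_map, hsp]; simp
  have hD : ∀ y : AlgebraicClosure F, aeval y (scD n x) = ∏ j ∈ Finset.range n, (y - x ^ (Fintype.card F) ^ j) := by
    intro y
    rw [aeval_def, ← eval_map, scD_map hx, eval_prod]; simp
  simp only [Multiset.insert_eq_cons, Multiset.map_cons, Multiset.map_singleton, Multiset.prod_cons, Multiset.prod_singleton, hD]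
  rw [← Finset.prod_mul_distrib, ← Finset.prod_pow_eq_pow_sum]
  refine Finset.prod_congr rfl (fun j _ => ?_)
  have h1 : aeval (x ^ (Fintype.card F) ^ j) p = (aeval x p) ^ (Fintype.card F) ^ j := by
    have := Polynomial.aeval_algHom_apply (FiniteField.frobeniusAlgHom F (AlgebraicClosure F) ^ j) x p
    simpa [AlgHom.coe_pow, FiniteField.coe_frobeniusAlgHom, pow_iterate] using this
  rw [← h1, he]; ring

theorem scN_lin {F : Type} [Field F] [Fintype F] (p : F[X]) (hp : Irreducible p) (hm : p.Monic) (hd : p.natDegree = 2)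
    (x : F) : scN p (X - C x) = p.eval x := by
  apply (algebraMap F (AlgebraicClosure F)).injective
  have hsp : p.map (algebraMap F (AlgebraicClosure F)) =
      ((p.aroots (AlgebraicClosure F)).map (fun α => X - C α)).prod :=
    (IsAlgClosed.splits _).eq_prod_roots_of_monic (hm.map _)
  have hcard : (p.aroots (AlgebraicClosure F)).card = 2 := by
    rw [← hd, ← natDegree_map (algebraMap F (AlgebraicClosure F))]
    exact ((IsAlgClosed.splits _).natDegree_eq_card_roots).symm
  rw [scN_roots p hp]
  obtain ⟨a, b, hab⟩ := Multiset.card_eq_two.mp hcard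
  rw [hab] at hsp ⊢
  have he : algebraMap F (AlgebraicClosure F) (p.eval x) = (algebraMap F _ x - a) * (algebraMap F _ x - b) := by
    rw [← aeval_algebraMap_apply_eq_algebraMap_eval, aeval_def, ← eval_map, hsp]; simp
  rw [he]
  simp
  ring

/-- vanishing of the sums of a nontrivial character mod R in large degree -/
theorem scC_vanish {F : Type} [Field F] [Fintype F] (ψ : F[X] →* ℂ) (R : F[X]) (hR : R.Monic)
    (hψ : ∀ g h, R ∣ g - h → ψ g = ψ h) (u : F[X]) (hu : IsCoprime u R) (hu1 : ψ u ≠ 1) (n : ℕ)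
    (hn : R.natDegree ≤ n) : scC ψ n = 0 := by
  classical
  let T : F[X] → F[X] := fun g => g + ((u * g - g) %ₘ R)
  have hTR : ∀ g, R ∣ T g - u * g := by
    intro g
    have h1 := modByMonic_add_div (u * g - g) R
    refine ⟨-((u * g - g) /ₘ R), ?_⟩
    simp only [T]
    linear_combination h1
  have hTmem : ∀ g ∈ scMon F n, T g ∈ scMon F n := by
    intro g hg
    rw [mem_scMon] at hg ⊢
    have hlt : ((u * g - g) %ₘ R).degree < g.degree := by
      refine (degree_modByMonic_lt _ hR).trans_le ?_
      rw [degree_eq_natDegree hR.ne_zero, degree_eq_natDegree hg.1.ne_zero, hg.2]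
      exact_mod_cast hn
    exact ⟨hg.1.add_of_left hlt, by
      rw [← hg.2]; exact natDegree_add_eq_left_of_degree_lt hlt⟩
  have hTinj : Set.InjOn T (scMon F n : Set F[X]) := by
    intro g _ h _ hgh
    have h1 : R ∣ u * (g - h) := by
      have := (hTR h).sub (hTR g)
      rw [hgh] at this
      convert this using 1; ring
    have h2 : R ∣ g - h := hu.symm.dvd_of_dvd_mul_left h1
    have h3 : R ∣ (u * g - g) - (u * h - h) := by
      have : (u * g - g) - (u * h - h) = (u - 1) * (g - h) := by ring
      rw [this]; exact dvd_mul_of_dvd_right h2 _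
    have h4 : (u * g - g) %ₘ R = (u * h - h) %ₘ R := by
      rw [← sub_eq_zero, ← sub_modByMonic]
      exact (modByMonic_eq_zero_iff_dvd hR).mpr h3
    simp only [T, h4] at hgh
    exact add_right_cancel hgh
  have himg : (scMon F n).image T = scMon F n := by
    apply Finset.eq_of_subset_of_card_le
    · intro g hg
      obtain ⟨h, hh, rfl⟩ := Finset.mem_image.mp hg
      exact hTmem h hh
    · rw [Finset.card_image_of_injOn hTinj]
  have h1 : scC ψ n = ψ u * scC ψ n := by
    unfold scC
    conv_lhs => rw [← himg, Finset.sum_image hTinj]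
    rw [Finset.mul_sum]
    refine Finset.sum_congr rfl (fun g _ => ?_)
    rw [hψ _ _ (hTR g), map_mul]
  have h2 : (1 - ψ u) * scC ψ n = 0 := by linear_combination h1
  rcases mul_eq_zero.mp h2 with h | h
  · exact absurd (sub_eq_zero.mp h).symm hu1
  · exact h

theorem scC_zero {F : Type} [Field F] [Fintype F] (ψ : F[X] →* ℂ) : scC ψ 0 = 1 := by
  have : scMon F 0 = {1} := by
    ext g
    rw [mem_scMon, Finset.mem_singleton]
    constructor
    · rintro ⟨h1, h2⟩; exact h1.natDegree_eq_zero.mp h2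
    · rintro rfl; simp
  simp [scC, this]

theorem scC_one {F : Type} [Field F] [Fintype F] (ψ : F[X] →* ℂ) : scC ψ 1 = ∑ x : F, ψ (X - C x) := by
  classical
  have : scMon F 1 = Finset.univ.image (fun x : F => (X - C x : F[X])) := by
    ext g
    rw [mem_scMon, Finset.mem_image]
    constructor
    · rintro ⟨h1, h2⟩
      refine ⟨- g.coeff 0, Finset.mem_univ _, ?_⟩
      rw [h1.eq_X_add_C h2]; simp
    · rintro ⟨x, _, rfl⟩; exact ⟨monic_X_sub_C x, natDegree_X_sub_C x⟩
  rw [scC, this, Finset.sum_image]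
  intro a _ b _ h
  simpa using h


theorem sc_count_bound {T : Type} {r : ℕ} (hr : 2 ≤ r) (ζ : ℂ) (hζ : IsPrimitiveRoot ζ r) (E : Finset T) (h : T → ℂ)
    (hval : ∀ x ∈ E, h x = 0 ∨ h x ^ r = 1) (M : ℝ) (hM : 0 ≤ M)
    (hN : ∀ j < r, (r : ℝ) * ((E.filter (fun x => h x = ζ ^ j)).card : ℝ) ≤ E.card + M)
    (Z : ℕ) (hZ : (E.filter (fun x => h x = 0)).card ≤ Z) : ‖∑ x ∈ E, h x‖ ≤ 2 * M + Z := by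
  classical
  have : NeZero r := ⟨by omega⟩
  have hζ0 : ζ ≠ 0 := hζ.ne_zero (by omega)
  have hinj : ∀ i < r, ∀ j < r, ζ ^ i = ζ ^ j → i = j := fun i hi j hj e => hζ.pow_inj hi hj e
  set N : ℕ → ℕ := fun j => (E.filter (fun x => h x = ζ ^ j)).card with hNdef
  have hpt : ∀ x ∈ E, h x = ∑ j ∈ Finset.range r, if h x = ζ ^ j then ζ ^ j else 0 := by
    intro x hx
    rcases hval x hx with h0 | h1
    · rw [h0]; symm; apply Finset.sum_eq_zero
      intro j _
      rw [if_neg]; exact (pow_ne_zero _ hζ0).symm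
    · obtain ⟨i, hi, hi2⟩ := hζ.eq_pow_of_pow_eq_one h1
      rw [Finset.sum_eq_single i]
      · rw [if_pos hi2.symm, hi2]
      · intro j hj hji
        rw [if_neg]; rw [← hi2]; intro e
        exact hji (hinj i hi j (Finset.mem_range.mp hj) e).symm
      · intro hh; exact absurd (Finset.mem_range.mpr hi) hh
  have hpt2 : ∀ x ∈ E, (1 : ℝ) = (∑ j ∈ Finset.range r, if h x = ζ ^ j then (1:ℝ) else 0) + if h x = 0 then (1:ℝ) else 0 := by
    intro x hx
    rcases hval x hx with h0 | h1
    · rw [if_pos h0, Finset.sum_eq_zero, zero_add]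
      intro j _
      rw [if_neg]; rw [h0]; exact (pow_ne_zero _ hζ0).symm
    · obtain ⟨i, hi, hi2⟩ := hζ.eq_pow_of_pow_eq_one h1
      rw [Finset.sum_eq_single i, if_pos hi2.symm, if_neg, add_zero]
      · rw [← hi2]; exact pow_ne_zero _ hζ0
      · intro j hj hji
        rw [if_neg]; rw [← hi2]; intro e
        exact hji (hinj i hi j (Finset.mem_range.mp hj) e).symm
      · intro hh; exact absurd (Finset.mem_range.mpr hi) hh
  have hS : ∑ x ∈ E, h x = ∑ j ∈ Finset.range r, (N j : ℂ) * ζ ^ j := by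
    rw [Finset.sum_congr rfl hpt, Finset.sum_comm]
    refine Finset.sum_congr rfl (fun j _ => ?_)
    rw [← Finset.sum_filter, Finset.sum_const, nsmul_eq_mul]
  have hQ : (E.card : ℝ) = (∑ j ∈ Finset.range r, (N j : ℝ)) + ((E.filter (fun x => h x = 0)).card : ℝ) := by
    have h1 : (E.card : ℝ) = ∑ x ∈ E, (1:ℝ) := by simp
    rw [h1, Finset.sum_congr rfl hpt2, Finset.sum_add_distrib, Finset.sum_comm]
    congr 1
    · refine Finset.sum_congr rfl (fun j _ => ?_)
      rw [← Finset.sum_filter, Finset.sum_const, nsmul_eq_mul, mul_one]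
    · rw [← Finset.sum_filter, Finset.sum_const, nsmul_eq_mul, mul_one]
  have hg : ∑ j ∈ Finset.range r, ζ ^ j = 0 := hζ.geom_sum_eq_zero (by omega)
  have hrS : (r : ℂ) * ∑ x ∈ E, h x = ∑ j ∈ Finset.range r, (((r : ℝ) * N j - E.card : ℝ) : ℂ) * ζ ^ j := by
    rw [hS, Finset.mul_sum]
    have : ∑ j ∈ Finset.range r, (E.card : ℂ) * ζ ^ j = 0 := by rw [← Finset.mul_sum, hg, mul_zero]
    rw [← sub_zero (∑ j ∈ Finset.range r, (r : ℂ) * ((N j : ℂ) * ζ ^ j)), ← this, ← Finset.sum_sub_distrib]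
    refine Finset.sum_congr rfl (fun j _ => ?_)
    push_cast; ring
  have hζn : ‖ζ‖ = 1 := hζ.norm'_eq_one (by omega)
  have hb : (r : ℝ) * ‖∑ x ∈ E, h x‖ ≤ r * (2 * M + Z) := by
    have e1 : (r : ℝ) * ‖∑ x ∈ E, h x‖ = ‖(r : ℂ) * ∑ x ∈ E, h x‖ := by simp
    rw [e1, hrS]
    refine (norm_sum_le _ _).trans ?_
    have e2 : ∀ j ∈ Finset.range r, ‖(((r : ℝ) * N j - E.card : ℝ) : ℂ) * ζ ^ j‖ ≤ 2 * M - ((r : ℝ) * N j - E.card) := by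
      intro j hj
      rw [norm_mul, norm_pow, hζn, one_pow, mul_one, Complex.norm_real, Real.norm_eq_abs]
      have := hN j (Finset.mem_range.mp hj)
      have h2 : (r : ℝ) * N j - E.card ≤ M := by linarith
      rw [abs_le]; constructor <;> linarith
    refine (Finset.sum_le_sum e2).trans ?_
    rw [Finset.sum_sub_distrib, Finset.sum_sub_distrib, ← Finset.mul_sum, ← Finset.mul_sum]
    simp only [Finset.sum_const, Finset.card_range, nsmul_eq_mul]
    have : ((E.filter (fun x => h x = 0)).card : ℝ) ≤ Z := by exact_mod_cast hZ
    have hr0 : (0:ℝ) ≤ r := by positivity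
    have h3 := mul_le_mul_of_nonneg_left this hr0
    have h4 : (r:ℝ) * E.card = r * (∑ j ∈ Finset.range r, (N j : ℝ)) + r * ((E.filter (fun x => h x = 0)).card : ℝ) := by
      rw [hQ]; ring
    linarith
  have hr0 : (0:ℝ) < r := by exact_mod_cast (by omega : 0 < r)
  exact le_of_mul_le_mul_left hb hr0

theorem sc_char_ker {F : Type} [Field F] [Fintype F] {r : ℕ} (hr : r.Prime) (hdvd : r ∣ Fintype.card F - 1)
    (χ : Fˣ →* (rootsOfUnity r ℂ)) (hχ : χ ≠ 1) (y z : Fˣ) (h : χ y = χ z) :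
    y ^ ((Fintype.card F - 1) / r) = z ^ ((Fintype.card F - 1) / r) := by
  classical
  obtain ⟨g, hg⟩ := IsCyclic.exists_generator (α := Fˣ)
  have hone : χ (y / z) = 1 := by rw [_root_.map_div, h, div_self']
  have hg1 : χ g ≠ 1 := by
    intro h1
    apply hχ
    ext w
    obtain ⟨k, hk⟩ := Subgroup.mem_zpowers_iff.mp (hg w)
    rw [← hk, map_zpow, h1, one_zpow]; rfl
  obtain ⟨k, hk⟩ := Subgroup.mem_zpowers_iff.mp (hg (y / z))
  have : Fact r.Prime := ⟨hr⟩
  have hord : orderOf (χ g) = r := by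
    apply orderOf_eq_prime _ hg1
    ext1
    exact (χ g).2
  rw [← hk, map_zpow] at hone
  have hrk : (r : ℤ) ∣ k := by rw [← hord]; exact orderOf_dvd_iff_zpow_eq_one.mpr hone
  obtain ⟨m, rfl⟩ := hrk
  rw [← div_eq_one, ← div_pow, ← hk, ← zpow_natCast, ← zpow_mul]
  have e : (r : ℤ) * m * (((Fintype.card F - 1) / r : ℕ) : ℤ) = ((Fintype.card F - 1 : ℕ) : ℤ) * m := by
    obtain ⟨c, hc⟩ := hdvd
    rw [hc, Nat.mul_div_cancel_left _ hr.pos]; push_cast; ring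
  rw [e, zpow_mul, zpow_natCast, ← Fintype.card_units, pow_card_eq_one, one_zpow]


noncomputable def scChar {F : Type} [Field F] {r : ℕ} (χ : Fˣ →* (rootsOfUnity r ℂ)) : MulChar F ℂ :=
  MulChar.ofUnitHom ((rootsOfUnity r ℂ).subtype.comp χ)

theorem scChar_unit {F : Type} [Field F] {r : ℕ} (χ : Fˣ →* (rootsOfUnity r ℂ)) (y : Fˣ) :
    scChar χ y = ((χ y : ℂˣ) : ℂ) := by
  simp [scChar]

noncomputable def scW {F : Type} [Field F] {L : ℕ} (p : Fin L → F[X]) (v : Fin L → ℕ) : F[X] →* F :=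
  ∏ i, (scN (p i)) ^ (v i)

theorem scW_apply {F : Type} [Field F] {L : ℕ} (p : Fin L → F[X]) (v : Fin L → ℕ) (g : F[X]) :
    scW p v g = ∏ i, (scN (p i) g) ^ (v i) := by
  simp [scW]

noncomputable def scPsi {F : Type} [Field F] {r L : ℕ} (χ : Fˣ →* (rootsOfUnity r ℂ)) (p : Fin L → F[X])
    (v : Fin L → ℕ) : F[X] →* ℂ :=
  (scChar χ : F →* ℂ).comp (scW p v)

theorem scPsi_apply {F : Type} [Field F] {r L : ℕ} (χ : Fˣ →* (rootsOfUnity r ℂ)) (p : Fin L → F[X])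
    (v : Fin L → ℕ) (g : F[X]) : scPsi χ p v g = scChar χ (scW p v g) := rfl

theorem scW_scD {F : Type} [Field F] [Fintype F] {L : ℕ} (p : Fin L → F[X]) (v : Fin L → ℕ)
    (hmon : ∀ i, (p i).Monic) (hirr : ∀ i, Irreducible (p i)) (hdeg : ∀ i, (p i).natDegree = 2)
    {n : ℕ} {x : AlgebraicClosure F} (hx : x ∈ scE F n) :
    algebraMap F (AlgebraicClosure F) (scW p v (scD n x)) =
      (aeval x (∏ i, p i ^ v i)) ^ (∑ j ∈ Finset.range n, (Fintype.card F) ^ j) := by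
  rw [scW_apply, map_prod, map_prod, ← Finset.prod_pow]
  refine Finset.prod_congr rfl (fun i _ => ?_)
  rw [map_pow, scN_scD (p i) (hirr i) (hmon i) (hdeg i) hx, map_pow, ← pow_mul, ← pow_mul, mul_comm]

theorem scW_lin {F : Type} [Field F] [Fintype F] {L : ℕ} (p : Fin L → F[X]) (v : Fin L → ℕ)
    (hmon : ∀ i, (p i).Monic) (hirr : ∀ i, Irreducible (p i)) (hdeg : ∀ i, (p i).natDegree = 2) (x : F) :
    scW p v (X - C x) = ∏ i, ((p i).eval x) ^ v i := by
  rw [scW_apply]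
  refine Finset.prod_congr rfl (fun i _ => ?_)
  rw [scN_lin (p i) (hirr i) (hmon i) (hdeg i)]

theorem sc_factor {F : Type} [Field F] [Fintype F] {L : ℕ} (p : Fin L → F[X]) (v : Fin L → ℕ)
    (hmon : ∀ i, (p i).Monic) (hirr : ∀ i, Irreducible (p i)) (hdist : Function.Injective p) (i0 : Fin L) :
    ∃ (α : AlgebraicClosure F) (f0 : (AlgebraicClosure F)[X]),
      (∏ i, p i ^ v i).map (algebraMap F (AlgebraicClosure F)) = (X - C α) ^ (v i0) * f0 ∧ f0.eval α ≠ 0 := by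
  classical
  obtain ⟨α, hα⟩ := IsAlgClosed.exists_aeval_eq_zero (AlgebraicClosure F) (p i0) (degree_pos_of_irreducible (hirr i0)).ne'
  have hsep : ((p i0).map (algebraMap F (AlgebraicClosure F))).Separable :=
    (PerfectField.separable_of_irreducible (hirr i0)).map
  have hroot : ((p i0).map (algebraMap F (AlgebraicClosure F))).IsRoot α := by
    rw [IsRoot, eval_map, ← aeval_def, hα]
  obtain ⟨h, hh⟩ := dvd_iff_isRoot.mpr hroot
  have hh0 : h.eval α ≠ 0 := by
    intro h0
    obtain ⟨k, hk⟩ := dvd_iff_isRoot.mpr (show h.IsRoot α from h0)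
    have h2 := hsep.squarefree (X - C α) ⟨k, by rw [hh, hk]; ring⟩
    exact (irreducible_X_sub_C α).not_isUnit h2
  refine ⟨α, h ^ (v i0) * ∏ i ∈ Finset.univ.erase i0, ((p i).map (algebraMap F (AlgebraicClosure F))) ^ v i, ?_, ?_⟩
  · rw [Polynomial.map_prod, ← Finset.mul_prod_erase _ _ (Finset.mem_univ i0), Polynomial.map_pow, hh, mul_pow, mul_assoc]
    simp
  · rw [eval_mul, eval_pow, eval_prod]
    refine mul_ne_zero (pow_ne_zero _ hh0) (Finset.prod_ne_zero_iff.mpr (fun i hi => ?_))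
    rw [eval_pow]
    refine pow_ne_zero _ (fun h0 => ?_)
    rw [eval_map, ← aeval_def] at h0
    have h1 := minpoly.eq_of_irreducible_of_monic (hirr i) h0 (hmon i)
    have h2 := minpoly.eq_of_irreducible_of_monic (hirr i0) hα (hmon i0)
    exact (Finset.ne_of_mem_erase hi) (hdist (h1.trans h2.symm))

theorem scS_bound {F : Type} [Field F] [Fintype F] {r L : ℕ} (hr : r.Prime) (hdvd : r ∣ Fintype.card F - 1)
    (χ : Fˣ →* (rootsOfUnity r ℂ)) (hχ : χ ≠ 1) (p : Fin L → F[X]) (v : Fin L → ℕ)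
    (hmon : ∀ i, (p i).Monic) (hirr : ∀ i, Irreducible (p i)) (hdist : Function.Injective p)
    (hdeg : ∀ i, (p i).natDegree = 2) (i0 : Fin L) (hv : ¬ r ∣ v i0) :
    ∃ B : ℝ, ∀ n, ‖scS (scPsi χ p v) n‖ ≤ B * (√(Fintype.card F)) ^ n := by
  classical
  obtain ⟨ch, hch⟩ := CharP.exists F
  have hchp : Fact ch.Prime := ⟨CharP.char_is_prime F ch⟩
  obtain ⟨k, hcp, hk⟩ := FiniteField.card F ch
  have : CharP (AlgebraicClosure F) ch := charP_of_injective_algebraMap (algebraMap F (AlgebraicClosure F)).injective ch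
  set q := Fintype.card F with hq
  have hq1 : 1 < q := Fintype.one_lt_card
  obtain ⟨α, f0, hf0, hα⟩ := sc_factor p v hmon hirr hdist i0
  set f := ∏ i, p i ^ v i with hf
  have hfm : f.Monic := monic_prod_of_monic _ _ (fun i _ => (hmon i).pow _)
  obtain ⟨D, hD0, hD⟩ := sc_stepanov_bound ch hr hv _ f0 α (hfm.map (algebraMap F (AlgebraicClosure F))) hf0 hα
  refine ⟨2 * D + f.natDegree, fun n => ?_⟩
  have hw1 : (1:ℝ) ≤ (√q) ^ n := by
    apply one_le_pow₀
    rw [Real.one_le_sqrt]; exact_mod_cast hq1.le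
  rcases Nat.eq_zero_or_pos n with rfl | hn
  · simp [scS, scE_zero]; positivity
  set t := ∑ j ∈ Finset.range n, q ^ j with ht
  have htpos : 0 < t := by
    apply Finset.sum_pos
    · intro i _; positivity
    · exact ⟨0, Finset.mem_range.mpr hn⟩
  obtain ⟨c, hc⟩ := hdvd
  have hgeom : (q - 1) * t + 1 = q ^ n := by
    have := Nat.geomSum_eq (m := q) (by omega) n
    have h2 : (q - 1) ∣ q ^ n - 1 := by simpa using Nat.sub_dvd_pow_sub_pow q 1 n
    have h3 : 1 ≤ q ^ n := Nat.one_le_pow _ _ (by omega)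
    rw [ht, this, Nat.mul_div_cancel' h2]; omega
  have hrs : r * (c * t) + 1 = q ^ n := by rw [← hgeom, hc, mul_assoc]
  have hcpos : 0 < c := by
    rcases Nat.eq_zero_or_pos c with h | h
    · rw [h] at hc; omega
    · exact h
  have hqn : ch ^ ((k : ℕ) * n) = r * (c * t) + 1 := by rw [hrs, pow_mul, ← hk]
  have hsq : √((r * (c * t) + 1 : ℕ) : ℝ) = (√q) ^ n := by
    rw [hrs]; push_cast; rw [Real.sqrt_eq_iff_mul_self_eq (by positivity) (by positivity), ← mul_pow, Real.mul_self_sqrt (by positivity)]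
  have hcdiv : (q - 1) / r = c := by rw [hc, Nat.mul_div_cancel_left _ hr.pos]
  have hζ := Complex.isPrimitiveRoot_exp r hr.ne_zero
  set ζ := Complex.exp (2 * Real.pi * Complex.I / r)
  have hWD : ∀ x ∈ scE F n, algebraMap F (AlgebraicClosure F) (scW p v (scD n x)) = (aeval x f) ^ t :=
    fun x hx => scW_scD p v hmon hirr hdeg hx
  have main := sc_count_bound hr.two_le ζ hζ (scE F n) (fun x => scPsi χ p v (scD n x)) ?_ (D * (√q) ^ n) (by positivity) ?_ f.natDegree ?_
  · refine main.trans ?_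
    have : (f.natDegree : ℝ) ≤ f.natDegree * (√q) ^ n := le_mul_of_one_le_right (by positivity) hw1
    nlinarith
  · intro x hx
    simp only [scPsi_apply]
    by_cases h0 : scW p v (scD n x) = 0
    · left; rw [h0]; exact MulChar.map_zero _
    · right
      have e : scW p v (scD n x) = (Units.mk0 _ h0 : Fˣ) := rfl
      rw [e, scChar_unit, ← Units.val_pow_eq_pow_val, (χ (Units.mk0 _ h0)).2]; rfl
  · intro j hj
    rw [card_scE F hn]
    set Zs := (scE F n).filter (fun x => scPsi χ p v (scD n x) = ζ ^ j) with hZs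
    have hζj : ζ ^ j ≠ 0 := pow_ne_zero _ (hζ.ne_zero hr.ne_zero)
    have hnz : ∀ x ∈ Zs, scW p v (scD n x) ≠ 0 := by
      intro x hx h0
      have := (Finset.mem_filter.mp hx).2
      rw [scPsi_apply, h0, MulChar.map_zero] at this
      exact hζj this.symm
    have key : ∃ b : AlgebraicClosure F, ∀ x ∈ Zs, algebraMap F (AlgebraicClosure F) (scW p v (scD n x) ^ c) = b := by
      rcases Zs.eq_empty_or_nonempty with h | ⟨x0, hx0⟩
      · exact ⟨0, by simp [h]⟩
      · refine ⟨_, fun x hx => congrArg _ (?_ : _ = scW p v (scD n x0) ^ c)⟩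
        have h1 : scChar χ (Units.mk0 _ (hnz x hx) : Fˣ) = scChar χ (Units.mk0 _ (hnz x0 hx0) : Fˣ) := by
          have a1 := (Finset.mem_filter.mp hx).2
          have a2 := (Finset.mem_filter.mp hx0).2
          exact a1.trans a2.symm
        rw [scChar_unit, scChar_unit] at h1
        have h2 : χ (Units.mk0 _ (hnz x hx)) = χ (Units.mk0 _ (hnz x0 hx0)) := by
          apply Subtype.ext; exact Units.ext h1
        have h3 := sc_char_ker hr ⟨c, hc⟩ χ hχ _ _ h2
        rw [← hq, hcdiv] at h3
        have h4 := congrArg (fun u : Fˣ => (u : F)) h3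
        simpa using h4
    obtain ⟨b, hb⟩ := key
    have h5 := hD _ _ hqn (Nat.mul_pos hcpos htpos) b Zs ?_
    · rw [hsq] at h5
      have e : ((r * (c * t) + 1 : ℕ) : ℝ) = ((q ^ n : ℕ) : ℝ) := by rw [hrs]
      rw [e] at h5
      exact h5
    · intro x hx
      have hxE := (Finset.mem_filter.mp hx).1
      refine ⟨?_, ?_, ?_⟩
      · rw [hrs]; exact (mem_scE' hn).mp hxE
      · rw [eval_map, ← aeval_def]
        intro h0
        have h6 := hWD x hxE
        rw [h0, zero_pow htpos.ne', map_eq_zero] at h6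
        exact hnz x hx h6
      · rw [← hb x hx, map_pow, hWD x hxE, eval_map, ← aeval_def, ← pow_mul, mul_comm]
  · have hsub : (scE F n).filter (fun x => scPsi χ p v (scD n x) = 0) ⊆ (f.map (algebraMap F (AlgebraicClosure F))).roots.toFinset := by
      intro x hx
      obtain ⟨hxE, h0⟩ := Finset.mem_filter.mp hx
      rw [Multiset.mem_toFinset, mem_roots (hfm.map _).ne_zero, IsRoot, eval_map, ← aeval_def]
      have h7 : scW p v (scD n x) = 0 := by
        by_contra hne
        have e : scW p v (scD n x) = (Units.mk0 _ hne : Fˣ) := rfl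
        rw [scPsi_apply, e, scChar_unit] at h0
        exact Units.ne_zero _ h0
      have h6 := hWD x hxE
      rw [h7, map_zero] at h6
      exact pow_eq_zero_iff htpos.ne' |>.mp h6.symm
    refine (Finset.card_le_card hsub).trans ((Multiset.toFinset_card_le _).trans ((card_roots' _).trans ?_))
    exact natDegree_map_le


theorem scN_zero {F : Type} [Field F] (p : F[X]) (hp : Irreducible p) : scN p 0 = 0 := by
  have : Fact (Irreducible p) := ⟨hp⟩
  have : FiniteDimensional F (AdjoinRoot p) := (AdjoinRoot.powerBasis hp.ne_zero).finite
  simp [scN, Algebra.norm_zero]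

theorem sc_nontriv {F : Type} [Field F] [Fintype F] {r L : ℕ} (hr : r.Prime)
    (χ : Fˣ →* (rootsOfUnity r ℂ)) (hχ : χ ≠ 1) (p : Fin L → F[X]) (v : Fin L → ℕ)
    (hmon : ∀ i, (p i).Monic) (hirr : ∀ i, Irreducible (p i)) (hdist : Function.Injective p)
    (i0 : Fin L) (hv : ¬ r ∣ v i0) :
    ∃ u : F[X], IsCoprime u (∏ i, p i) ∧ scPsi χ p v u ≠ 1 := by
  classical
  obtain ⟨w, hw⟩ : ∃ w, χ w ≠ 1 := by
    by_contra! h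
    exact hχ (MonoidHom.ext h)
  obtain ⟨Y, hY⟩ := scN_surj (p i0) (hirr i0) w
  have hcop : IsCoprime (p i0) (∏ i ∈ Finset.univ.erase i0, p i) := by
    refine IsCoprime.prod_right (fun i hi => ?_)
    refine ((hirr i0).coprime_iff_not_dvd).mpr (fun hd => ?_)
    have := eq_of_monic_of_associated (hmon i0) (hmon i) ((hirr i0).associated_of_dvd (hirr i) hd)
    exact Finset.ne_of_mem_erase hi (hdist this).symm
  obtain ⟨a, b, hab⟩ := hcop
  set R' := ∏ i ∈ Finset.univ.erase i0, p i with hR'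
  set u := 1 + (Y - 1) * (b * R') with hu
  have h0 : scN (p i0) u = w := by
    rw [← hY]
    apply scN_congr
    refine ⟨-(Y - 1) * a, ?_⟩
    rw [hu]; linear_combination (Y - 1) * hab
  have h1 : ∀ i, i ≠ i0 → scN (p i) u = 1 := by
    intro i hi
    rw [← map_one (scN (p i))]
    apply scN_congr
    have : p i ∣ R' := Finset.dvd_prod_of_mem _ (Finset.mem_erase.mpr ⟨hi, Finset.mem_univ _⟩)
    rw [hu, add_sub_cancel_left]
    exact dvd_mul_of_dvd_right (dvd_mul_of_dvd_right this _) _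
  have hne : ∀ i, scN (p i) u ≠ 0 := by
    intro i
    by_cases hi : i = i0
    · rw [hi, h0]; exact w.ne_zero
    · rw [h1 i hi]; exact one_ne_zero
  refine ⟨u, ?_, ?_⟩
  · refine IsCoprime.prod_right (fun i _ => ?_)
    refine IsCoprime.symm (((hirr i).coprime_iff_not_dvd).mpr (fun hd => hne i ?_))
    rw [scN_congr (p i) u 0 (by simpa using hd), scN_zero _ (hirr i)]
  · have hW : scW p v u = ((w ^ v i0 : Fˣ) : F) := by
      rw [scW_apply, Finset.prod_eq_single i0, h0, Units.val_pow_eq_pow_val]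
      · intro i _ hi; rw [h1 i hi, one_pow]
      · intro h; exact absurd (Finset.mem_univ _) h
    rw [scPsi_apply, hW, scChar_unit, map_pow]
    intro h
    have h2 : (χ w) ^ v i0 = 1 := by
      apply Subtype.ext; exact Units.ext h
    have : Fact r.Prime := ⟨hr⟩
    have hord : orderOf (χ w) = r := by
      apply orderOf_eq_prime _ hw
      ext1
      exact (χ w).2
    exact hv (hord ▸ orderOf_dvd_of_pow_eq_one h2)

theorem sc_weil {F : Type} [Field F] [Fintype F] {r L : ℕ} (hr : r.Prime) (hdvd : r ∣ Fintype.card F - 1)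
    (χ : Fˣ →* (rootsOfUnity r ℂ)) (hχ : χ ≠ 1) (p : Fin L → F[X]) (v : Fin L → ℕ)
    (hmon : ∀ i, (p i).Monic) (hirr : ∀ i, Irreducible (p i)) (hdist : Function.Injective p)
    (hdeg : ∀ i, (p i).natDegree = 2) (i0 : Fin L) (hv : ¬ r ∣ v i0) :
    ‖∑ x : F, scChar χ (∏ i, ((p i).eval x) ^ v i)‖ ≤ ((2 * L - 1 : ℕ) : ℝ) * √(Fintype.card F) := by
  obtain ⟨B, hB⟩ := scS_bound hr hdvd χ hχ p v hmon hirr hdist hdeg i0 hv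
  obtain ⟨u, hu, hu1⟩ := sc_nontriv hr χ hχ p v hmon hirr hdist i0 hv
  have hRm : (∏ i, p i).Monic := monic_prod_of_monic _ _ (fun i _ => hmon i)
  have hRd : (∏ i, p i).natDegree = 2 * L := by
    rw [natDegree_prod_of_monic _ _ (fun i _ => hmon i)]
    simp [hdeg, mul_comm]
  have hq0 : (0:ℝ) < √(Fintype.card F) := Real.sqrt_pos.mpr (by exact_mod_cast Fintype.card_pos)
  have hL : 0 < L := i0.pos
  have h := sc_analytic (scC (scPsi χ p v)) (scS (scPsi χ p v)) (2 * L - 1) ?_ (scC_zero _) _ B hq0 hB (sc_newton _)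
  · rw [scC_one] at h
    simp only [scPsi_apply, scW_lin p v hmon hirr hdeg] at h
    exact h
  · intro n hn
    refine scC_vanish _ (∏ i, p i) hRm ?_ u hu hu1 n (by rw [hRd]; omega)
    intro g h hgh
    rw [scPsi_apply, scPsi_apply, scW_apply, scW_apply]
    congr 1
    refine Finset.prod_congr rfl (fun i _ => ?_)
    rw [scN_congr (p i) g h ((Finset.dvd_prod_of_mem _ (Finset.mem_univ i)).trans hgh)]


/-- If `P` consists of `L` distinct monic irreducible quadratics and
`L < (q(r−1)−1)/(2r√q)`, then the shadow code has `F_r`-dimension exactly `L`. -/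
theorem shadow_code_dimension_quadratics
    (r q L : ℕ) (hr : r.Prime) (F : Type) [Field F] [Fintype F]
    (hq : Fintype.card F = q) (hq3 : 3 ≤ q)
    (hpp : ∃ p k : ℕ, p.Prime ∧ 0 < k ∧ q = p ^ k) (hdvd : r ∣ q - 1)
    (χ : Fˣ →* (rootsOfUnity r ℂ)) (hχord : orderOf χ = r)
    (φ : (rootsOfUnity r ℂ) → ZMod r)
    (hφbij : Function.Bijective φ)
    (hφadd : ∀ a b : (rootsOfUnity r ℂ), φ (a * b) = φ a + φ b)
    (p : Fin L → Polynomial F) (hmon : ∀ i, (p i).Monic)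
    (hirr : ∀ i, Irreducible (p i)) (hdist : Function.Injective p)
    (hdeg : ∀ i, (p i).natDegree = 2)
    (hnz : ∀ i (x : F), (p i).eval x ≠ 0)
    (hL : (L : ℝ) < ((q : ℝ) * ((r : ℝ) - 1) - 1) / (2 * (r : ℝ) * Real.sqrt q)) :
    Module.finrank (ZMod r)
      (Submodule.span (ZMod r) (Set.range (shadowEv χ φ p hnz))) = L := by
  have hfr : Fact r.Prime := ⟨hr⟩
  have hφ1 : φ 1 = 0 := by
    have := hφadd 1 1
    rw [mul_one] at this
    exact left_eq_add.mp this
  have hφpow : ∀ (a : rootsOfUnity r ℂ) (n : ℕ), φ (a ^ n) = n * φ a := by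
    intro a n
    induction n with
    | zero => simp [hφ1]
    | succ n ih => rw [pow_succ, hφadd, ih]; push_cast; ring
  have hφprod : ∀ g : Fin L → rootsOfUnity r ℂ, φ (∏ i, g i) = ∑ i, φ (g i) := by
    intro g
    let Φ : rootsOfUnity r ℂ →* Multiplicative (ZMod r) :=
      { toFun := fun a => Multiplicative.ofAdd (φ a), map_one' := by rw [hφ1]; rfl,
        map_mul' := fun a b => by rw [hφadd]; rfl }
    have h := map_prod Φ g Finset.univ
    have h2 := congrArg Multiplicative.toAdd h
    rw [toAdd_prod] at h2
    exact h2
  have hev : ∀ v x, shadowEv χ φ p hnz v x = ∑ i, v i * φ (χ (Units.mk0 ((p i).eval x) (hnz i x))) := by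
    intro v x
    unfold shadowEv
    rw [map_prod, hφprod]
    refine Finset.sum_congr rfl (fun i _ => ?_)
    rw [map_pow, hφpow, ZMod.natCast_zmod_val]
  let T : (Fin L → ZMod r) →ₗ[ZMod r] (F → ZMod r) :=
    { toFun := shadowEv χ φ p hnz
      map_add' := by
        intro v w; funext x
        simp only [hev, Pi.add_apply, add_mul, Finset.sum_add_distrib]
      map_smul' := by
        intro c v; funext x
        simp only [hev, Pi.smul_apply, smul_eq_mul, RingHom.id_apply, Finset.mul_sum, mul_assoc] }
  have hrange : Submodule.span (ZMod r) (Set.range (shadowEv χ φ p hnz)) = LinearMap.range T := by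
    have : Set.range (shadowEv χ φ p hnz) = (LinearMap.range T : Set (F → ZMod r)) := rfl
    rw [this, Submodule.span_eq]
  rw [hrange]
  have hinj : Function.Injective T := by
    rw [← LinearMap.ker_eq_bot, LinearMap.ker_eq_bot']
    intro v hTv
    by_contra hv0
    obtain ⟨i0, hi0⟩ : ∃ i, v i ≠ 0 := by
      by_contra! h
      exact hv0 (funext h)
    have hvd : ¬ r ∣ (v i0).val := by
      intro hd
      apply hi0
      rw [← ZMod.natCast_zmod_val (v i0)]
      exact (ZMod.natCast_eq_zero_iff _ _).mpr hd
    have hχ : χ ≠ 1 := by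
      intro h
      rw [h, orderOf_one] at hχord
      exact hr.one_lt.ne hχord
    have hw := sc_weil hr (by rw [hq]; exact hdvd) χ hχ p (fun i => (v i).val) hmon hirr hdist hdeg i0 hvd
    have hone : ∀ x : F, scChar χ (∏ i, ((p i).eval x) ^ (v i).val) = 1 := by
      intro x
      have h1 : shadowEv χ φ p hnz v x = 0 := congrFun hTv x
      unfold shadowEv at h1
      rw [← hφ1] at h1
      have h2 := hφbij.1 h1
      have e : ∏ i, ((p i).eval x) ^ (v i).val =
          ((∏ i, (Units.mk0 ((p i).eval x) (hnz i x)) ^ (v i).val : Fˣ) : F) := by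
        push_cast; simp
      rw [e, scChar_unit, h2]; simp
    simp only [hone, Finset.sum_const, Finset.card_univ, hq, nsmul_eq_mul, mul_one] at hw
    have hqR : (3:ℝ) ≤ q := by exact_mod_cast hq3
    have hw2 : (q : ℝ) ≤ ((2 * L - 1 : ℕ) : ℝ) * √q := by simpa using hw
    have hLpos : 0 < L := i0.pos
    have hc : ((2 * L - 1 : ℕ) : ℝ) ≤ 2 * L := by
      exact_mod_cast (by omega : 2 * L - 1 ≤ 2 * L)
    have hs : 0 < √(q : ℝ) := Real.sqrt_pos.mpr (by linarith)
    have hrR : (2:ℝ) ≤ r := by exact_mod_cast hr.two_le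
    rw [lt_div_iff₀ (by positivity)] at hL
    have h3 : (q : ℝ) ≤ 2 * L * √q := hw2.trans (mul_le_mul_of_nonneg_right hc hs.le)
    have h4 : (q : ℝ) * r ≤ (2 * L * √q) * r := mul_le_mul_of_nonneg_right h3 (by linarith)
    nlinarith
  rw [LinearMap.finrank_range_of_inj hinj]
  simp
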